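/- arXiv:2511.20805 — 3 statements merged into one kernel-verified Lean document; each statement's English description precedes it below -/
import Mathlib

section
/- Let P be a maximal non-hyperelliptic lattice polygon with g interior lattice points, r(P) boundary lattice points, c(P) column vectors, and lattice width d (so d > 1). Then g + r(P) − 3 − c(P) ≤ g + 2g/(d − 1) + 2d − 3; equivalently, r(P) − c(P) ≤ 2g/(d − 1) + 2d. -/
open Set

noncomputable section

/-- Embedding of the integer lattice `ℤ × ℤ` into the real plane. -/
def latticeEmbed (p : ℤ × ℤ) : ℝ × ℝ := ((p.1 : ℝ), (p.2 : ℝ))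

/-- A lattice polygon: the convex hull of a nonempty finite set of lattice points. -/
def IsLatticePolygon (P : Set (ℝ × ℝ)) : Prop :=
  ∃ S : Finset (ℤ × ℤ), S.Nonempty ∧
    P = convexHull ℝ (latticeEmbed '' (S : Set (ℤ × ℤ)))

/-- The interior lattice points of a set in the plane. -/
def interiorLatticePoints (P : Set (ℝ × ℝ)) : Set (ℤ × ℤ) :=
  {p : ℤ × ℤ | latticeEmbed p ∈ interior P}

/-- The genus of a lattice polygon: the number of interior lattice points. -/
def polygonGenus (P : Set (ℝ × ℝ)) : ℕ := (interiorLatticePoints P).ncard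

/-- The number of lattice points on the boundary. -/
def boundaryLatticeCount (P : Set (ℝ × ℝ)) : ℕ :=
  {p : ℤ × ℤ | latticeEmbed p ∈ frontier P}.ncard

/-- A subset of the plane is two-dimensional if it has nonempty interior. -/
def TwoDimensional (P : Set (ℝ × ℝ)) : Prop := (interior P).Nonempty

/-- A `ℤ`-affine transformation of the plane: `p ↦ A p + b` with `A ∈ GL₂(ℤ)`, `b ∈ ℤ²`. -/
def IsZAffine (φ : ℝ × ℝ → ℝ × ℝ) : Prop :=
  ∃ a b c d e f : ℤ, (a * d - b * c = 1 ∨ a * d - b * c = -1) ∧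
    ∀ p : ℝ × ℝ,
      φ p = ((a : ℝ) * p.1 + (b : ℝ) * p.2 + (e : ℝ),
             (c : ℝ) * p.1 + (d : ℝ) * p.2 + (f : ℝ))

/-- The horizontal strip `ℝ × [0, s]`. -/
def strip (s : ℝ) : Set (ℝ × ℝ) := {q : ℝ × ℝ | 0 ≤ q.2 ∧ q.2 ≤ s}

/-- `LatticeWidthIs P d` : `d` is the smallest positive integer `s` such that some
`ℤ`-affine transformation maps `P` into the strip `ℝ × [0, s]`. -/
def LatticeWidthIs (P : Set (ℝ × ℝ)) (d : ℕ) : Prop :=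
  IsLeast {s : ℕ | 0 < s ∧ ∃ φ, IsZAffine φ ∧ φ '' P ⊆ strip (s : ℝ)} d

/-- An edge of a polygon: an exposed face of dimension one. -/
def IsEdge (P τ : Set (ℝ × ℝ)) : Prop :=
  IsExposed ℝ P τ ∧ Module.finrank ℝ (vectorSpan ℝ τ) = 1

/-- A column vector of a polygon `P`: a nonzero integer vector `v` such that for some
edge `τ` of `P`, translating all lattice points of `P` off `τ` by `v` stays in `P`. -/
def IsColumnVector (P : Set (ℝ × ℝ)) (v : ℤ × ℤ) : Prop :=
  v ≠ 0 ∧ ∃ τ : Set (ℝ × ℝ), IsEdge P τ ∧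
    ∀ p : ℤ × ℤ, latticeEmbed p ∈ P \ τ → latticeEmbed (p + v) ∈ P

/-- The number of column vectors of `P`. -/
def columnVectorCount (P : Set (ℝ × ℝ)) : ℕ :=
  {v : ℤ × ℤ | IsColumnVector P v}.ncard

/-- A lattice polygon is maximal if no lattice polygon strictly containing it has the
same set of interior lattice points. -/
def IsMaximalPolygon (P : Set (ℝ × ℝ)) : Prop :=
  IsLatticePolygon P ∧
    ∀ Q : Set (ℝ × ℝ), IsLatticePolygon Q → P ⊆ Q →
      interiorLatticePoints Q = interiorLatticePoints P → Q = P

/-- The interior polygon: the convex hull of the interior lattice points. -/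
def interiorPolygon (P : Set (ℝ × ℝ)) : Set (ℝ × ℝ) :=
  convexHull ℝ (latticeEmbed '' interiorLatticePoints P)

/-- A lattice polygon is non-hyperelliptic if its interior polygon is two-dimensional. -/
def NonHyperelliptic (P : Set (ℝ × ℝ)) : Prop := TwoDimensional (interiorPolygon P)

/-- Two polygons are equivalent if one is the image of the other under a
`ℤ`-affine transformation. -/
def EquivPolygon (P Q : Set (ℝ × ℝ)) : Prop := ∃ φ, IsZAffine φ ∧ φ '' P = Q

/-- The triangle `2Υ = conv{(−2,−2),(2,0),(0,2)}`. -/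
def twoUpsilon : Set (ℝ × ℝ) :=
  convexHull ℝ {((-2 : ℝ), (-2 : ℝ)), ((2 : ℝ), (0 : ℝ)), ((0 : ℝ), (2 : ℝ))}

/-- `ExpectedGonalityIs P d` : the expected gonality of `P` is `d`, i.e.
`d = lw(P⁽¹⁾) + 2`, except that polygons equivalent to `2Υ` have expected gonality `3`. -/
def ExpectedGonalityIs (P : Set (ℝ × ℝ)) (d : ℕ) : Prop :=
  (EquivPolygon P twoUpsilon ∧ d = 3) ∨
  (¬ EquivPolygon P twoUpsilon ∧
    ∃ w : ℕ, LatticeWidthIs (interiorPolygon P) w ∧ d = w + 2)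

/-- `Q` contains a crystal of length `d`: a `(d+1) × (d−1)` grid of interior lattice
points occupying columns `x₀, …, x₀ + d` and rows `1, …, d − 1`. -/
def ContainsCrystal (Q : Set (ℝ × ℝ)) (d : ℕ) : Prop :=
  ∃ x₀ : ℤ, ∀ i j : ℤ, 0 ≤ i → i ≤ (d : ℤ) → 1 ≤ j → j ≤ (d : ℤ) - 1 →
    (x₀ + i, j) ∈ interiorLatticePoints Q

/-- The shear transformation `(x, y) ↦ (x + ℓ y, y)`. -/
def shearMap (ℓ : ℤ) : ℝ × ℝ → ℝ × ℝ := fun q => (q.1 + (ℓ : ℝ) * q.2, q.2)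

end


/-- The leftmost coordinate of the row at height `y`. -/
noncomputable def lft (Q : Set (ℝ × ℝ)) (y : ℝ) : ℝ := sInf {x : ℝ | (x, y) ∈ Q}

lemma sum_aux (f : ℕ → ℝ) (n : ℕ) :
    ∑ k ∈ Finset.range n, (f k + f (k+2) - 2 * f (k+1)) * (k+1 : ℝ)
      = n * f (n+1) - (n+1) * f n + f 0 := by
  induction n with
  | zero => simp
  | succ n ih => rw [Finset.sum_range_succ, ih]; push_cast; ring

lemma sum_tent (f : ℕ → ℝ) (n : ℕ) :
    ∑ k ∈ Finset.range n, (f k + f (k+2) - 2 * f (k+1)) * ((k+1 : ℝ) * (n - k))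
      = n * (f 0 + f (n+1)) - 2 * ∑ k ∈ Finset.range n, f (k+1) := by
  induction n with
  | zero => simp
  | succ n ih =>
    have h1 : ∀ k : ℕ, (f k + f (k+2) - 2 * f (k+1)) * ((k+1 : ℝ) * ((n+1 : ℕ) - k))
      = (f k + f (k+2) - 2 * f (k+1)) * ((k+1 : ℝ) * (n - k))
        + (f k + f (k+2) - 2 * f (k+1)) * (k+1 : ℝ) := by intro k; push_cast; ring
    rw [Finset.sum_congr rfl (fun k _ => h1 k), Finset.sum_add_distrib, sum_aux,
      Finset.sum_range_succ, ih, Finset.sum_range_succ]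
    push_cast; ring

lemma tent_ge (f : ℕ → ℝ) (n : ℕ) (hc : ∀ k < n, 0 ≤ f k + f (k+2) - 2 * f (k+1)) :
    2 * ∑ k ∈ Finset.range n, f (k+1) ≤ n * (f 0 + f (n+1)) := by
  have h := sum_tent f n
  have : 0 ≤ ∑ k ∈ Finset.range n, (f k + f (k+2) - 2 * f (k+1)) * ((k+1 : ℝ) * (n - k)) := by
    apply Finset.sum_nonneg
    intro k hk
    have hk := Finset.mem_range.1 hk
    have : (k : ℝ) < n := by exact_mod_cast hk
    exact mul_nonneg (hc k hk) (mul_nonneg (by positivity) (by linarith))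
  linarith

lemma tent_ge_one (f : ℕ → ℝ) (n : ℕ) (hc : ∀ k < n, 0 ≤ f k + f (k+2) - 2 * f (k+1))
    (k : ℕ) (hk : k < n) (hb : 1 ≤ f k + f (k+2) - 2 * f (k+1)) :
    2 * ∑ k ∈ Finset.range n, f (k+1) + n ≤ n * (f 0 + f (n+1)) := by
  have h := sum_tent f n
  have h0 : (f k + f (k+2) - 2 * f (k+1)) * ((k+1 : ℝ) * (n - k))
      ≤ ∑ k ∈ Finset.range n, (f k + f (k+2) - 2 * f (k+1)) * ((k+1 : ℝ) * (n - k)) := by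
    apply Finset.single_le_sum (f := fun k : ℕ =>
      (f k + f (k+2) - 2 * f (k+1)) * ((k+1 : ℝ) * (n - k))) _ (Finset.mem_range.2 hk)
    intro k hk
    have hk := Finset.mem_range.1 hk
    have : (k : ℝ) < n := by exact_mod_cast hk
    exact mul_nonneg (hc k hk) (mul_nonneg (by positivity) (by linarith))
  have hkn : (k : ℝ) + 1 ≤ n := by exact_mod_cast hk
  have hk0 : (0 : ℝ) ≤ k := by positivity
  have h2 : (n : ℝ) ≤ (k+1 : ℝ) * (n - k) := by nlinarith
  nlinarith

lemma affine_seq (f : ℕ → ℝ) (n : ℕ) (hc : ∀ k < n, f k + f (k+2) - 2 * f (k+1) = 0) :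
    ∀ j ≤ n + 1, f j = f 0 + j * (f 1 - f 0) := by
  intro j
  induction j using Nat.strong_induction_on with
  | _ j ih =>
    intro hj
    match j, ih, hj with
    | 0, _, _ => simp
    | 1, _, _ => simp
    | k+2, ih, hj =>
      have h1 := ih k (by omega) (by omega)
      have h2 := ih (k+1) (by omega) (by omega)
      have h3 := hc k (by omega)
      push_cast at *
      linarith

/-- Standing hypotheses: lattice polygon in the strip touching rows `0` and `d`. -/
structure Good (Q : Set (ℝ × ℝ)) (d : ℕ) : Prop where
  poly : ∃ S : Finset (ℤ × ℤ), Q = convexHull ℝ (latticeEmbed '' (S : Set (ℤ × ℤ))) ∧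
    (∀ s ∈ S, 0 ≤ s.2 ∧ s.2 ≤ d) ∧ (∃ s ∈ S, s.2 = 0) ∧ (∃ s ∈ S, s.2 = d)
  two : (interior Q).Nonempty

lemma poly_convex_compact {Q : Set (ℝ × ℝ)} (S : Finset (ℤ × ℤ))
    (h : Q = convexHull ℝ (latticeEmbed '' (S : Set (ℤ × ℤ)))) : Convex ℝ Q ∧ IsCompact Q := by
  subst h
  exact ⟨convex_convexHull _ _, (S.finite_toSet.image _).isCompact_convexHull (𝕜 := ℝ)⟩

lemma Good.convex {Q d} (h : Good Q d) : Convex ℝ Q := by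
  obtain ⟨S, hS, -⟩ := h.poly; exact (poly_convex_compact S hS).1
lemma Good.compact {Q d} (h : Good Q d) : IsCompact Q := by
  obtain ⟨S, hS, -⟩ := h.poly; exact (poly_convex_compact S hS).2

lemma Good.strip {Q d} (h : Good Q d) {p : ℝ × ℝ} (hp : p ∈ Q) : 0 ≤ p.2 ∧ p.2 ≤ d := by
  obtain ⟨S, hS, hs, -⟩ := h.poly
  have hconv : Convex ℝ {p : ℝ × ℝ | 0 ≤ p.2 ∧ p.2 ≤ d} := by
    rintro ⟨x, y⟩ ⟨h1, h2⟩ ⟨x', y'⟩ ⟨h3, h4⟩ a b ha hb hab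
    simp only [mem_ofPred_eq, Prod.snd_add, Prod.smul_snd, smul_eq_mul] at *
    constructor
    · positivity
    · calc a * y + b * y' ≤ a * d + b * d := by gcongr
        _ = d := by rw [← add_mul, hab, one_mul]
  rw [hS] at hp
  refine convexHull_min ?_ hconv hp
  rintro _ ⟨s, hs', rfl⟩
  have := hs s hs'
  simp only [latticeEmbed, mem_ofPred_eq]
  exact ⟨by exact_mod_cast this.1, by exact_mod_cast this.2⟩

lemma Good.exists_zero {Q d} (h : Good Q d) : ∃ x : ℝ, (x, (0:ℝ)) ∈ Q := by
  obtain ⟨S, hS, hs, ⟨s, h1, h2⟩, -⟩ := h.poly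
  refine ⟨s.1, ?_⟩
  rw [hS]
  refine subset_convexHull _ _ ⟨s, h1, by simp [latticeEmbed, h2]⟩

lemma Good.exists_top {Q d} (h : Good Q d) : ∃ x : ℝ, (x, (d:ℝ)) ∈ Q := by
  obtain ⟨S, hS, hs, -, ⟨s, h1, h2⟩⟩ := h.poly
  refine ⟨s.1, ?_⟩
  rw [hS]
  refine subset_convexHull _ _ ⟨s, h1, by simp [latticeEmbed, h2]⟩

lemma conv2 {Q : Set (ℝ × ℝ)} (h : Convex ℝ Q) {x y x' y' a b : ℝ} (h1 : (x, y) ∈ Q)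
    (h2 : (x', y') ∈ Q) (ha : 0 ≤ a) (hb : 0 ≤ b) (hab : a + b = 1) :
    (a * x + b * x', a * y + b * y') ∈ Q := by
  simpa using h h1 h2 ha hb hab

lemma Good.row_nonempty {Q d} (h : Good Q d) (hd : 0 < d) {y : ℝ} (h0 : 0 ≤ y) (h1 : y ≤ d) :
    {x : ℝ | (x, y) ∈ Q}.Nonempty := by
  obtain ⟨x, hx⟩ := h.exists_zero
  obtain ⟨x', hx'⟩ := h.exists_top
  have hd' : (0:ℝ) < d := by exact_mod_cast hd
  have := conv2 h.convex hx hx' (a := 1 - y / d) (b := y / d)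
    (by rw [sub_nonneg, div_le_one hd']; exact h1) (by positivity) (by ring)
  refine ⟨(1 - y/d) * x + y/d * x', ?_⟩
  change ((1 - y/d) * x + y/d * x', y) ∈ Q
  convert this using 2
  field_simp
  ring

lemma Good.row_compact {Q d} (h : Good Q d) (y : ℝ) : IsCompact {x : ℝ | (x, y) ∈ Q} := by
  have h1 : {x : ℝ | (x, y) ∈ Q} = Prod.fst '' (Q ∩ {p | p.2 = y}) := by
    ext x
    simp
  rw [h1]
  refine IsCompact.image (h.compact.inter_right ?_) continuous_fst
  exact isClosed_eq continuous_snd continuous_const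

lemma Good.lft_mem {Q d} (h : Good Q d) (hd : 0 < d) {y : ℝ} (h0 : 0 ≤ y) (h1 : y ≤ d) :
    (lft Q y, y) ∈ Q :=
  (h.row_compact y).sInf_mem (h.row_nonempty hd h0 h1)

lemma Good.lft_le {Q d} (h : Good Q d) {x y : ℝ} (hx : (x, y) ∈ Q) : lft Q y ≤ x :=
  csInf_le (h.row_compact y).bddBelow hx

lemma Good.lft_convex {Q d} (h : Good Q d) (k : ℕ) (hk : k + 2 ≤ d) :
    0 ≤ lft Q (k : ℕ) + lft Q ((k+2 : ℕ)) - 2 * lft Q ((k+1 : ℕ)) := by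
  have hk' : ((k + 2 : ℕ) : ℝ) ≤ d := by exact_mod_cast hk
  push_cast at *
  have h1 := h.lft_mem (by omega) (y := k) (by positivity) (by linarith)
  have h2 := h.lft_mem (by omega) (y := k+2) (by positivity) (by linarith)
  have h3 := conv2 h.convex h1 h2 (a := 1/2) (b := 1/2) (by norm_num) (by norm_num) (by norm_num)
  have h4 : (1 / 2 * lft Q k + 1 / 2 * lft Q (k + 2), (k + 1 : ℝ)) ∈ Q := by
    convert h3 using 2; ring
  have := h.lft_le h4
  linarith

lemma Good.lft_int {Q d} (h : Good Q d) (hd : 0 < d) {y : ℝ} (hy : y = 0 ∨ y = d) :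
    ∃ m : ℤ, lft Q y = m := by
  have hm : (lft Q y, y) ∈ Q := by
    rcases hy with rfl | rfl
    · exact h.lft_mem hd le_rfl (by positivity)
    · exact h.lft_mem hd (by positivity) le_rfl
  have hext : (lft Q y, y) ∈ Q.extremePoints ℝ := by
    refine ⟨hm, ?_⟩
    rintro ⟨x1, y1⟩ h1 ⟨x2, y2⟩ h2 ⟨a, b, ha, hb, hab, he⟩
    simp only [Prod.smul_mk, Prod.mk_add_mk, smul_eq_mul, Prod.mk.injEq] at he ⊢
    have s1 := h.strip h1
    have s2 := h.strip h2
    simp only at s1 s2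
    have hb' : b = 1 - a := by linarith
    subst hb'
    have : y1 = y ∧ y2 = y := by
      rcases hy with rfl | rfl
      · constructor <;> nlinarith
      · constructor <;> nlinarith
    obtain ⟨rfl, rfl⟩ := this
    have t1 := h.lft_le h1
    have t2 := h.lft_le h2
    have : x1 = lft Q y2 := by nlinarith
    simp [this]
  obtain ⟨S, hS, -⟩ := h.poly
  rw [hS] at hext
  obtain ⟨s, hs, he⟩ := extremePoints_convexHull_subset hext
  refine ⟨s.1, ?_⟩
  simp only [latticeEmbed, Prod.mk.injEq] at he
  rw [hS]; exact he.1.symm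

/-- Compatible real and integral affine transformations. -/
structure ZT (Φ : (ℝ × ℝ) ≃ᵃ[ℝ] (ℝ × ℝ)) (e L : (ℤ × ℤ) ≃ (ℤ × ℤ)) : Prop where
  emb : ∀ p, latticeEmbed (e p) = Φ (latticeEmbed p)
  lin : ∀ p v, e (p + v) = e p + L v
  zero : L 0 = 0

lemma exists_ZT (a b c d e f : ℤ) (hdet : a * d - b * c = 1 ∨ a * d - b * c = -1) :
    ∃ Φ E L, ZT Φ E L ∧ (∀ p : ℝ × ℝ, Φ p = ((a : ℝ) * p.1 + (b : ℝ) * p.2 + (e : ℝ),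
             (c : ℝ) * p.1 + (d : ℝ) * p.2 + (f : ℝ))) ∧
      ∀ v : ℤ × ℤ, L v = (a * v.1 + b * v.2, c * v.1 + d * v.2) := by
  obtain ⟨ε, hε, hε2⟩ : ∃ ε : ℤ, (a * d - b * c) * ε = 1 ∧ ε * ε = 1 := by
    rcases hdet with h | h
    · exact ⟨1, by rw [h]; norm_num, by norm_num⟩
    · exact ⟨-1, by rw [h]; norm_num, by norm_num⟩
  have hR : ((a:ℝ) * d - b * c) * ε = 1 := by exact_mod_cast hε
  let A : (ℝ × ℝ) ≃ₗ[ℝ] (ℝ × ℝ) :=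
    { toFun := fun p => (a * p.1 + b * p.2, c * p.1 + d * p.2)
      map_add' := by intro p q; ext <;> simp <;> ring
      map_smul' := by intro r q; ext <;> simp <;> ring
      invFun := fun p => (ε * (d * p.1 - b * p.2), ε * (a * p.2 - c * p.1))
      left_inv := by
        rintro ⟨x, y⟩
        ext
        · simp only; linear_combination x * hR
        · simp only; linear_combination y * hR
      right_inv := by
        rintro ⟨x, y⟩
        ext
        · simp only; linear_combination x * hR
        · simp only; linear_combination y * hR }
  let L : (ℤ × ℤ) ≃ (ℤ × ℤ) :=
    { toFun := fun p => (a * p.1 + b * p.2, c * p.1 + d * p.2)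
      invFun := fun p => (ε * (d * p.1 - b * p.2), ε * (a * p.2 - c * p.1))
      left_inv := by
        rintro ⟨x, y⟩
        ext
        · simp only; linear_combination x * hε
        · simp only; linear_combination y * hε
      right_inv := by
        rintro ⟨x, y⟩
        ext
        · simp only; linear_combination x * hε
        · simp only; linear_combination y * hε }
  let Φ : (ℝ × ℝ) ≃ᵃ[ℝ] (ℝ × ℝ) :=
    { toEquiv := A.toEquiv.trans (Equiv.addRight ((e : ℝ), (f : ℝ)))
      linear := A
      map_vadd' := by
        intro p v
        simp only [vadd_eq_add, Equiv.trans_apply, Equiv.coe_addRight]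
        change A (v + p) + _ = A v + (A p + _)
        rw [map_add, add_assoc] }
  refine ⟨Φ, L.trans (Equiv.addRight (e, f)), L, ⟨?_, ?_, ?_⟩, ?_, ?_⟩
  · intro p
    change latticeEmbed ((a * p.1 + b * p.2, c * p.1 + d * p.2) + (e, f)) =
      (((a * (p.1:ℝ) + b * (p.2:ℝ), c * (p.1:ℝ) + d * (p.2:ℝ)) : ℝ × ℝ) + ((e : ℝ), (f : ℝ)))
    simp [latticeEmbed]
  · intro p v
    change ((a * (p.1+v.1) + b * (p.2+v.2), c * (p.1+v.1) + d * (p.2+v.2)) + (e, f) : ℤ × ℤ) =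
      ((a * p.1 + b * p.2, c * p.1 + d * p.2) + (e, f) : ℤ × ℤ) +
      (a * v.1 + b * v.2, c * v.1 + d * v.2)
    ext <;> simp <;> ring
  · change ((a * 0 + b * 0, c * 0 + d * 0) : ℤ × ℤ) = 0
    ext <;> simp
  · intro p; rfl
  · intro v; rfl

lemma ZT.mem {Φ e L} (h : ZT Φ e L) (X : Set (ℝ × ℝ)) (p : ℤ × ℤ) :
    latticeEmbed (e p) ∈ Φ '' X ↔ latticeEmbed p ∈ X := by
  rw [h.emb]; exact Φ.injective.mem_set_image

lemma ZT.ncard {Φ e L} (h : ZT Φ e L) (X : Set (ℝ × ℝ)) :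
    {p : ℤ × ℤ | latticeEmbed p ∈ Φ '' X}.ncard = {p : ℤ × ℤ | latticeEmbed p ∈ X}.ncard := by
  rw [← Set.ncard_image_of_injective {p : ℤ × ℤ | latticeEmbed p ∈ X} e.injective]
  congr 1
  ext q
  obtain ⟨p, rfl⟩ := e.surjective q
  rw [e.injective.mem_set_image]
  exact h.mem X p

lemma image_interior (Φ : (ℝ × ℝ) ≃ᵃ[ℝ] (ℝ × ℝ)) (X : Set (ℝ × ℝ)) :
    interior (Φ '' X) = Φ '' interior X :=
  ((AffineEquiv.toContinuousAffineEquiv Φ).toHomeomorph.image_interior X).symm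

lemma image_frontier (Φ : (ℝ × ℝ) ≃ᵃ[ℝ] (ℝ × ℝ)) (X : Set (ℝ × ℝ)) :
    frontier (Φ '' X) = Φ '' frontier X :=
  ((AffineEquiv.toContinuousAffineEquiv Φ).toHomeomorph.image_frontier X).symm

lemma ZT.col {Φ e L} (h : ZT Φ e L) {P : Set (ℝ × ℝ)} {v : ℤ × ℤ}
    (hc : IsColumnVector (Φ '' P) (L v)) : IsColumnVector P v := by
  obtain ⟨h0, τ, ⟨hexp, hfin⟩, hτ⟩ := hc
  refine ⟨by rintro rfl; exact h0 h.zero, Φ ⁻¹' τ, ⟨?_, ?_⟩, ?_⟩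
  · intro hne
    obtain ⟨x, hx⟩ := hne
    obtain ⟨l, hl⟩ := hexp ⟨_, hx⟩
    let A : (ℝ × ℝ) →L[ℝ] (ℝ × ℝ) := LinearMap.toContinuousLinearMap (Φ.linear : (ℝ × ℝ) →ₗ[ℝ] (ℝ × ℝ))
    have key : ∀ p q : ℝ × ℝ, l (Φ p) ≤ l (Φ q) ↔ (l.comp A) p ≤ (l.comp A) q := by
      intro p q
      have h1 : Φ p - Φ q = A (p - q) := by
        have := Φ.toAffineMap.linearMap_vsub p q
        simpa [A] using this.symm
      have h2 : l (Φ p) - l (Φ q) = (l.comp A) p - (l.comp A) q := by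
        rw [← map_sub, h1, ← map_sub]; rfl
      constructor <;> intro h3 <;> linarith
    refine ⟨l.comp A, ?_⟩
    ext p
    rw [hl]
    simp only [mem_preimage, mem_ofPred_eq, Φ.injective.mem_set_image, forall_mem_image, key]
  · have : τ = Φ '' (Φ ⁻¹' τ) := (Set.image_preimage_eq _ Φ.surjective).symm
    rw [this] at hfin
    have h2 := Φ.toAffineMap.map_vectorSpan (s := Φ ⁻¹' τ)
    rw [← hfin]
    have h3 : vectorSpan ℝ (Φ '' (Φ ⁻¹' τ)) =
      Submodule.map (Φ.linear : (ℝ × ℝ) →ₗ[ℝ] (ℝ × ℝ)) (vectorSpan ℝ (Φ ⁻¹' τ)) := h2.symm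
    rw [h3]
    exact (LinearEquiv.finrank_map_eq Φ.linear _).symm
  · intro p hp
    have := hτ (e p) ⟨(h.mem _ _).2 hp.1, by rw [h.emb]; exact hp.2⟩
    rw [← h.lin] at this
    exact (h.mem _ _).1 this

lemma finite_lattice {Q : Set (ℝ × ℝ)} (hQ : IsCompact Q) :
    {p : ℤ × ℤ | latticeEmbed p ∈ Q}.Finite := by
  obtain ⟨R, hR⟩ := hQ.isBounded.exists_norm_le
  refine ((Finset.Icc (-⌈R⌉) ⌈R⌉ ×ˢ Finset.Icc (-⌈R⌉) ⌈R⌉).finite_toSet).subset ?_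
  intro p hp
  have h1 := hR _ hp
  have h2 := (norm_fst_le (latticeEmbed p)).trans h1
  have h3 := (norm_snd_le (latticeEmbed p)).trans h1
  simp only [latticeEmbed, Real.norm_eq_abs] at h2 h3
  have hc := Int.le_ceil R
  rw [abs_le] at h2 h3
  simp only [Finset.coe_product, Finset.coe_Icc, mem_prod, mem_Icc]
  refine ⟨⟨?_, ?_⟩, ?_, ?_⟩ <;> (have : True := trivial) <;> rify <;> linarith [h2.1, h2.2, h3.1, h3.2]

lemma finite_col {Q : Set (ℝ × ℝ)} (S : Finset (ℤ × ℤ))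
    (hS : Q = convexHull ℝ (latticeEmbed '' (S : Set (ℤ × ℤ)))) (h2 : (interior Q).Nonempty) :
    {v : ℤ × ℤ | IsColumnVector Q v}.Finite := by
  have hfin := finite_lattice (poly_convex_compact S hS).2
  refine ((hfin.prod hfin).image (fun pq => pq.2 - pq.1)).subset ?_
  rintro v ⟨-, τ, ⟨hexp, hrk⟩, hv⟩
  have hex : ∃ s ∈ S, latticeEmbed s ∉ τ := by
    by_contra! hcon
    have hsub : Q ⊆ τ := by
      rw [hS]
      refine convexHull_min ?_ ?_
      · rintro _ ⟨s, hs, rfl⟩; exact hcon s hs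
      · exact hexp.convex (poly_convex_compact S hS).1
    have htop := affineSpan_eq_top_of_nonempty_interior (s := τ)
      ((h2.mono (interior_mono hsub)).mono (interior_mono (subset_convexHull ℝ _)))
    have hvs : vectorSpan ℝ τ = ⊤ := by
      rw [← direction_affineSpan, htop, AffineSubspace.direction_top]
    rw [hvs, finrank_top] at hrk
    simp at hrk
  obtain ⟨s, hs, hsτ⟩ := hex
  have hsQ : latticeEmbed s ∈ Q := by rw [hS]; exact subset_convexHull _ _ ⟨s, hs, rfl⟩
  exact ⟨(s, s + v), ⟨hsQ, hv s ⟨hsQ, hsτ⟩⟩, by simp⟩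

open Classical in
/-- `1` if the left end of row `k + 1` is not a lattice point, else `0`. -/
noncomputable def defect (Q : Set (ℝ × ℝ)) (k : ℕ) : ℕ :=
  if ∃ m : ℤ, lft Q ((k + 1 : ℕ) : ℝ) = m then 0 else 1

lemma Good.side_nonneg {Q n} (h : Good Q (n+1)) :
    2 * ∑ k ∈ Finset.range n, (⌊lft Q ((k+1 : ℕ) : ℝ)⌋ : ℝ) ≤
      n * (lft Q ((0 : ℕ) : ℝ) + lft Q ((n+1 : ℕ) : ℝ)) := by
  have h1 := tent_ge (fun k : ℕ => lft Q (k : ℝ)) n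
    (fun k hk => h.lft_convex k (by omega))
  have h2 : ∑ k ∈ Finset.range n, (⌊lft Q ((k+1 : ℕ) : ℝ)⌋ : ℝ) ≤
      ∑ k ∈ Finset.range n, lft Q ((k+1 : ℕ) : ℝ) :=
    Finset.sum_le_sum (fun k _ => Int.floor_le _)
  linarith

lemma Good.straight_col {Q n} (h : Good Q (n+1)) (m k : ℤ)
    (hl : ∀ j : ℕ, j ≤ n + 1 → lft Q (j : ℝ) = m + j * k) :
    IsColumnVector Q (-1, 0) := by
  have hlow : ∀ p : ℤ × ℤ, latticeEmbed p ∈ Q → m + p.2 * k ≤ p.1 := by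
    intro p hp
    have h1 := h.strip hp
    simp only [latticeEmbed] at h1
    have h2 : 0 ≤ p.2 ∧ p.2 ≤ (n+1 : ℕ) := by exact_mod_cast h1
    obtain ⟨j, hj⟩ := Int.eq_ofNat_of_zero_le h2.1
    have h3 := h.lft_le (x := p.1) (y := p.2) hp
    have h4 := hl j (by omega)
    rw [hj] at h3 ⊢
    push_cast at h3
    rw [h4] at h3
    exact_mod_cast h3
  have hge : ∀ p ∈ Q, (m : ℝ) ≤ p.1 - k * p.2 := by
    intro p hp
    obtain ⟨S, hS, -⟩ := h.poly
    have hconv : Convex ℝ {p : ℝ × ℝ | (m : ℝ) ≤ p.1 - k * p.2} := by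
      rintro ⟨x, y⟩ h1 ⟨x', y'⟩ h3 a b ha hb hab
      simp only [mem_ofPred_eq, Prod.fst_add, Prod.smul_fst, Prod.snd_add, Prod.smul_snd, smul_eq_mul] at *
      calc (m : ℝ) = a * m + b * m := by rw [← add_mul, hab, one_mul]
        _ ≤ a * (x - k * y) + b * (x' - k * y') := by gcongr
        _ = _ := by ring
    have hp' := hp
    rw [hS] at hp'
    refine convexHull_min ?_ hconv hp'
    rintro _ ⟨s, hs, rfl⟩
    have h1 := hlow s (by rw [hS]; exact subset_convexHull _ _ ⟨s, hs, rfl⟩)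
    have h2 : (m : ℝ) + s.2 * k ≤ s.1 := by exact_mod_cast h1
    simp only [mem_ofPred_eq, latticeEmbed]
    linarith
  have hb0 : ((m : ℝ), (0:ℝ)) ∈ Q := by
    have := h.lft_mem (by omega) (y := 0) le_rfl (by positivity)
    have h0 := hl 0 (by omega)
    simp at h0
    rwa [h0] at this
  have ht : ((m : ℝ) + (n+1) * k, (n + 1:ℝ)) ∈ Q := by
    have := h.lft_mem (by omega) (y := ((n+1 : ℕ) : ℝ)) (by positivity) le_rfl
    rw [hl (n+1) le_rfl] at this
    push_cast at this
    exact this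
  refine ⟨by simp, {p | p ∈ Q ∧ p.1 - k * p.2 = m}, ⟨?_, ?_⟩, ?_⟩
  · intro _
    refine ⟨(k : ℝ) • ContinuousLinearMap.snd ℝ ℝ ℝ - ContinuousLinearMap.fst ℝ ℝ ℝ, ?_⟩
    ext p
    simp only [mem_ofPred_eq, sub_apply, smul_apply,
      ContinuousLinearMap.coe_snd', ContinuousLinearMap.coe_fst', smul_eq_mul]
    refine and_congr_right (fun hp => ⟨fun he q hq => ?_, fun hq => ?_⟩)
    · have := hge q hq
      linarith
    · have h1 := hq _ hb0
      have h2 := hge p hp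
      linarith
  · have hsp : vectorSpan ℝ {p : ℝ × ℝ | p ∈ Q ∧ p.1 - k * p.2 = m} =
        Submodule.span ℝ {((k : ℝ), (1 : ℝ))} := by
      apply le_antisymm
      · rw [vectorSpan_def, Submodule.span_le]
        rintro _ ⟨p, ⟨-, hp⟩, q, ⟨-, hq⟩, rfl⟩
        rw [SetLike.mem_coe, Submodule.mem_span_singleton]
        refine ⟨p.2 - q.2, ?_⟩
        ext
        · simp; linarith
        · simp
      · rw [Submodule.span_le, singleton_subset_iff, SetLike.mem_coe]
        have h1 := vsub_mem_vectorSpan ℝ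
          (s := {p : ℝ × ℝ | p ∈ Q ∧ p.1 - k * p.2 = m})
          (p₁ := ((m : ℝ) + (n+1) * k, (n + 1:ℝ))) (p₂ := ((m : ℝ), (0:ℝ)))
          ⟨ht, by simp only; ring⟩ ⟨hb0, by simp⟩
        have h2 := Submodule.smul_mem _ ((n + 1 : ℝ)⁻¹) h1
        have hn : (n + 1 : ℝ) ≠ 0 := by positivity
        convert h2 using 1
        ext
        · simp; field_simp
        · simp; field_simp
    rw [hsp, finrank_span_singleton (by simp)]
  · intro p hp
    have h1 := hlow p hp.1
    have h2 : m + p.2 * k ≠ p.1 := by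
      intro he
      apply hp.2
      refine ⟨hp.1, ?_⟩
      have : (m : ℝ) + p.2 * k = p.1 := by exact_mod_cast he
      simp only [latticeEmbed]; linarith
    have h3 : m + p.2 * k ≤ p.1 - 1 := by omega
    have h3' : (m : ℝ) + p.2 * k ≤ p.1 - 1 := by exact_mod_cast h3
    have hs := h.strip hp.1
    simp only [latticeEmbed] at hs
    have hnat : 0 ≤ p.2 ∧ p.2 ≤ (n+1 : ℕ) := by exact_mod_cast hs
    obtain ⟨j, hj⟩ := Int.eq_ofNat_of_zero_le hnat.1
    have hlm := h.lft_mem (by omega) hs.1 hs.2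
    have hle : lft Q (p.2 : ℝ) = m + p.2 * k := by
      rw [hj]; exact_mod_cast hl j (by omega)
    rw [hle] at hlm
    -- convex combination
    have hpos : (0:ℝ) < p.1 - (m + p.2 * k) := by linarith
    have hc := conv2 h.convex hlm (show ((p.1 : ℝ), (p.2 : ℝ)) ∈ Q from hp.1)
      (a := 1 / (p.1 - (m + p.2 * k))) (b := 1 - 1 / (p.1 - (m + p.2 * k)))
      (by positivity) (by rw [sub_nonneg, div_le_one hpos]; linarith) (by ring)
    convert hc using 1
    simp only [latticeEmbed, Prod.mk.injEq, Prod.fst_add, Prod.snd_add]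
    push_cast
    constructor
    · field_simp; ring
    · ring

lemma Good.side {Q n} (h : Good Q (n+1)) :
    1 ≤ ∑ k ∈ Finset.range n, defect Q k ∨ IsColumnVector Q (-1, 0) ∨
    2 * ∑ k ∈ Finset.range n, (⌊lft Q ((k+1 : ℕ) : ℝ)⌋ : ℝ) + n ≤
      n * (lft Q ((0 : ℕ) : ℝ) + lft Q ((n+1 : ℕ) : ℝ)) := by
  by_cases hD : 1 ≤ ∑ k ∈ Finset.range n, defect Q k
  · exact Or.inl hD
  right
  have hD0 : ∑ k ∈ Finset.range n, defect Q k = 0 := by omega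
  rw [Finset.sum_eq_zero_iff] at hD0
  have hint : ∀ j : ℕ, j ≤ n + 1 → ∃ m : ℤ, lft Q (j : ℝ) = m := by
    intro j hj
    rcases Nat.eq_zero_or_pos j with rfl | hj0
    · exact h.lft_int (by omega) (Or.inl (by simp))
    rcases hj.eq_or_lt with rfl | hj1
    · exact h.lft_int (by omega) (Or.inr rfl)
    obtain ⟨i, rfl⟩ : ∃ i, j = i + 1 := ⟨j - 1, by omega⟩
    have := hD0 i (Finset.mem_range.2 (by omega))
    unfold defect at this
    by_contra hcon
    rw [if_neg hcon] at this
    omega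
  by_cases hb : ∃ k < n, 1 ≤ lft Q (k : ℕ) + lft Q ((k+2 : ℕ)) - 2 * lft Q ((k+1 : ℕ))
  · right
    obtain ⟨k, hk, hk1⟩ := hb
    have h1 := tent_ge_one (fun k : ℕ => lft Q (k : ℝ)) n
      (fun k hk => h.lft_convex k (by omega)) k hk hk1
    have h2 : ∑ k ∈ Finset.range n, (⌊lft Q ((k+1 : ℕ) : ℝ)⌋ : ℝ) ≤
        ∑ k ∈ Finset.range n, lft Q ((k+1 : ℕ) : ℝ) :=
      Finset.sum_le_sum (fun k _ => Int.floor_le _)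
    linarith
  · left
    push Not at hb
    have h0 : ∀ k < n, lft Q (k : ℕ) + lft Q ((k+2 : ℕ)) - 2 * lft Q ((k+1 : ℕ)) = 0 := by
      intro k hk
      have h1 := hb k hk
      have h2 := h.lft_convex k (by omega)
      obtain ⟨a, ha⟩ := hint k (by omega)
      obtain ⟨b, hb⟩ := hint (k+1) (by omega)
      obtain ⟨c, hc⟩ := hint (k+2) (by omega)
      rw [ha, hb, hc] at h1 h2 ⊢
      norm_cast at *
      omega
    obtain ⟨m, hm⟩ := hint 0 (by omega)
    obtain ⟨m', hm'⟩ := hint 1 (by omega)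
    have h1 := affine_seq (fun k : ℕ => lft Q (k : ℝ)) n h0
    refine h.straight_col m (m' - m) (fun j hj => ?_)
    have := h1 j hj
    rw [this, hm, hm']
    push_cast
    ring

lemma image_poly {Φ e L} (h : ZT Φ e L) (S : Finset (ℤ × ℤ)) :
    Φ '' convexHull ℝ (latticeEmbed '' (S : Set (ℤ × ℤ))) =
      convexHull ℝ (latticeEmbed '' ((S.map e.toEmbedding : Finset (ℤ × ℤ)) : Set (ℤ × ℤ))) := by
  have h1 := Φ.toAffineMap.image_convexHull (latticeEmbed '' (S : Set (ℤ × ℤ)))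
  have h2 : Φ '' convexHull ℝ (latticeEmbed '' (S : Set (ℤ × ℤ))) =
    convexHull ℝ (Φ '' (latticeEmbed '' (S : Set (ℤ × ℤ)))) := h1
  rw [h2]
  congr 1
  rw [Finset.coe_map, image_image, image_image]
  apply image_congr
  intro s _
  exact (h.emb s).symm

lemma Good.mirror {Q d} (h : Good Q d) : ∃ Q', Good Q' d ∧
    (∀ x y : ℝ, (x, y) ∈ Q' ↔ (-x, y) ∈ Q) ∧
    (IsColumnVector Q' (-1, 0) → IsColumnVector Q (1, 0)) := by
  obtain ⟨Φ, e, L, hz, hΦ, hL⟩ := exists_ZT (-1) 0 0 1 0 0 (by norm_num)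
  refine ⟨Φ '' Q, ⟨?_, ?_⟩, ?_, ?_⟩
  · obtain ⟨S, hS, h1, ⟨s, hs, hs0⟩, ⟨t, ht, ht0⟩⟩ := h.poly
    have he : ∀ p, (e p).2 = p.2 := by
      intro p
      have := congrArg Prod.snd (hz.emb p)
      rw [hΦ] at this
      simpa [latticeEmbed] using this
    refine ⟨S.map e.toEmbedding, by rw [hS]; exact image_poly hz S, ?_, ?_, ?_⟩
    · intro q hq
      obtain ⟨p, hp, rfl⟩ := Finset.mem_map.1 hq
      simpa [he] using h1 p hp
    · exact ⟨e s, Finset.mem_map.2 ⟨s, hs, rfl⟩, by rw [he, hs0]⟩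
    · exact ⟨e t, Finset.mem_map.2 ⟨t, ht, rfl⟩, by rw [he, ht0]⟩
  · rw [image_interior]; exact h.two.image _
  · intro x y
    have : (x, y) = Φ (-x, y) := by rw [hΦ]; simp
    rw [this]; exact Φ.injective.mem_set_image
  · intro hc
    apply hz.col
    rw [hL]
    simpa using hc

lemma Good.mem_interior {Q d} (h : Good Q d) {a x b y : ℝ} (ha : (a, y) ∈ Q) (hb : (b, y) ∈ Q)
    (hax : a < x) (hxb : x < b) (h0 : 0 < y) (h1 : y < d) : (x, y) ∈ interior Q := by
  by_contra hcon
  obtain ⟨f, hf⟩ := geometric_hahn_banach_open_point h.convex.interior isOpen_interior hcon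
  have hle : ∀ p ∈ Q, f p ≤ f (x, y) := by
    intro p hp
    have hcl : p ∈ closure (interior Q) := by
      rw [h.convex.closure_interior_eq_closure_of_nonempty_interior h.two]
      exact subset_closure hp
    have : closure (interior Q) ⊆ {p | f p ≤ f (x, y)} :=
      closure_minimal (fun q hq => (hf q hq).le) (isClosed_le f.continuous continuous_const)
    exact this hcl
  have hlin : ∀ p : ℝ × ℝ, f p = p.1 * f (1, 0) + p.2 * f (0, 1) := by
    intro p
    have : p = p.1 • ((1:ℝ), (0:ℝ)) + p.2 • ((0:ℝ), (1:ℝ)) := by ext <;> simp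
    conv_lhs => rw [this]
    simp only [map_add, map_smul, smul_eq_mul]
  obtain ⟨u, hu⟩ := h.exists_zero
  obtain ⟨w, hw⟩ := h.exists_top
  obtain ⟨z, hz⟩ := h.two
  have i1 := hle _ ha
  have i2 := hle _ hb
  have i3 := hle _ hu
  have i4 := hle _ hw
  have i5 := hf z hz
  rw [hlin, hlin (x, y)] at i1 i2 i3 i4 i5
  simp only at i1 i2 i3 i4 i5
  have e1 : f (1, 0) = 0 := by nlinarith
  rw [e1] at i3 i4 i5
  have e2 : f (0, 1) = 0 := by nlinarith
  rw [e2] at i5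
  linarith

lemma Good.genus_ge {Q Q' n} (h : Good Q (n+1)) (h' : Good Q' (n+1))
    (hm : ∀ x y : ℝ, (x, y) ∈ Q' ↔ (-x, y) ∈ Q) :
    ∑ k ∈ Finset.range n, (-(⌊lft Q' ((k+1 : ℕ) : ℝ)⌋ : ℝ) - ⌊lft Q ((k+1 : ℕ) : ℝ)⌋ - 1) ≤
      (polygonGenus Q : ℝ) := by
  let T : Finset (Σ _ : ℕ, ℤ) := (Finset.range n).sigma
    (fun k => Finset.Ioo ⌊lft Q ((k+1 : ℕ) : ℝ)⌋ (-⌊lft Q' ((k+1 : ℕ) : ℝ)⌋))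
  let F : (Σ _ : ℕ, ℤ) → ℤ × ℤ := fun t => (t.2, (t.1 : ℤ) + 1)
  have hF : Function.Injective F := by
    rintro ⟨a, b⟩ ⟨c, d⟩ he
    simp only [F, Prod.mk.injEq] at he
    obtain ⟨rfl, h2⟩ := he
    have : a = c := by omega
    subst this; rfl
  have hsub : F '' (T : Set (Σ _ : ℕ, ℤ)) ⊆ interiorLatticePoints Q := by
    rintro _ ⟨⟨k, x⟩, ht, rfl⟩
    simp only [T, Finset.coe_sigma, Set.mem_sigma_iff, Finset.mem_coe, Finset.mem_range,
      Finset.mem_Ioo] at ht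
    obtain ⟨hk, h1, h2⟩ := ht
    have hk' : ((k+1 : ℕ) : ℝ) < (n+1 : ℕ) := by exact_mod_cast (by omega : k + 1 < n + 1)
    have m1 := h.lft_mem (by omega) (y := ((k+1 : ℕ) : ℝ)) (by positivity) hk'.le
    have m2 := h'.lft_mem (by omega) (y := ((k+1 : ℕ) : ℝ)) (by positivity) hk'.le
    rw [hm] at m2
    have h1' := Int.floor_lt.1 h1
    have h2' : lft Q' ((k+1 : ℕ) : ℝ) < ((-x : ℤ) : ℝ) := Int.floor_lt.1 (by omega)
    push_cast at h2'
    have := h.mem_interior m1 m2 h1' (by push_cast; linarith) (by positivity) hk'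
    simpa [interiorLatticePoints, F, latticeEmbed] using this
  have hfin : (interiorLatticePoints Q).Finite :=
    (finite_lattice h.compact).subset (fun p hp => (interior_subset (s := Q) hp : latticeEmbed p ∈ Q))
  have hcard : T.card ≤ polygonGenus Q := by
    have := Set.ncard_le_ncard hsub hfin
    rwa [Set.ncard_image_of_injective _ hF, Set.ncard_coe_finset] at this
  refine le_trans ?_ (Nat.cast_le.2 hcard)
  rw [Finset.card_sigma, Nat.cast_sum]
  refine Finset.sum_le_sum (fun k _ => ?_)
  rw [Int.card_Ioo]
  have := Int.self_le_toNat (-⌊lft Q' ((k+1 : ℕ) : ℝ)⌋ - ⌊lft Q ((k+1 : ℕ) : ℝ)⌋ - 1)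
  exact_mod_cast this

open Classical in
/-- Candidate boundary lattice points in row `j`. -/
noncomputable def brow (Q Q' : Set (ℝ × ℝ)) (n j : ℕ) : Finset ℤ :=
  if j = 0 ∨ j = n + 1 then Finset.Icc ⌊lft Q (j : ℝ)⌋ (-⌊lft Q' (j : ℝ)⌋)
  else (if ∃ m : ℤ, lft Q (j : ℝ) = m then {⌊lft Q (j : ℝ)⌋} else ∅) ∪
    (if ∃ m : ℤ, lft Q' (j : ℝ) = m then {-⌊lft Q' (j : ℝ)⌋} else ∅)

lemma Good.bdry_le {Q Q' n} (h : Good Q (n+1)) (h' : Good Q' (n+1))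
    (hm : ∀ x y : ℝ, (x, y) ∈ Q' ↔ (-x, y) ∈ Q) :
    (boundaryLatticeCount Q : ℝ) ≤ 2 * (n + 1)
      - (lft Q ((0 : ℕ) : ℝ) + lft Q ((n+1 : ℕ) : ℝ))
      - (lft Q' ((0 : ℕ) : ℝ) + lft Q' ((n+1 : ℕ) : ℝ))
      - ((∑ k ∈ Finset.range n, defect Q k : ℕ) : ℝ)
      - ((∑ k ∈ Finset.range n, defect Q' k : ℕ) : ℝ) := by
  let T : Finset (Σ _ : ℕ, ℤ) := (Finset.range (n+2)).sigma (brow Q Q' n)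
  let F : (Σ _ : ℕ, ℤ) → ℤ × ℤ := fun t => (t.2, (t.1 : ℤ))
  have hsub : {p : ℤ × ℤ | latticeEmbed p ∈ frontier Q} ⊆ F '' (T : Set (Σ _ : ℕ, ℤ)) := by
    rintro ⟨x, y⟩ hp
    have hp : ((x : ℝ), (y : ℝ)) ∈ frontier Q := hp
    rw [h.compact.isClosed.frontier_eq] at hp
    obtain ⟨hpQ, hpi⟩ := hp
    have hs := h.strip hpQ
    simp only at hs
    have hs' : 0 ≤ y ∧ y ≤ (n+1 : ℕ) := by exact_mod_cast hs
    obtain ⟨j, rfl⟩ := Int.eq_ofNat_of_zero_le hs'.1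
    refine ⟨⟨j, x⟩, ?_, rfl⟩
    simp only [T, Finset.coe_sigma, Set.mem_sigma_iff, Finset.mem_coe, Finset.mem_range]
    refine ⟨by omega, ?_⟩
    simp only [Int.ofNat_eq_natCast, Int.cast_natCast] at hpQ hpi hs
    have hpQ' : (-(x:ℝ), (j : ℝ)) ∈ Q' := by rw [hm]; simpa using hpQ
    have l1 := h.lft_le hpQ
    have l2 := h'.lft_le hpQ'
    unfold brow
    split_ifs with c0 c1 c2 c2
    all_goals try
      simp only [Finset.mem_Icc, Finset.mem_union, Finset.mem_singleton, Finset.notMem_empty,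
        or_false, false_or]
    · constructor
      · exact_mod_cast (Int.floor_le _).trans l1
      · have : ⌊lft Q' (j : ℝ)⌋ ≤ -x := by
          exact_mod_cast (Int.floor_le _).trans l2
        omega
    all_goals
      have hj0 : (0:ℝ) < j := by exact_mod_cast (by omega : 0 < j)
      have hj1 : (j:ℝ) < (n+1 : ℕ) := by exact_mod_cast (by omega : j < n+1)
      have m1 := h.lft_mem (by omega) hj0.le hj1.le
      have m2 := h'.lft_mem (by omega) hj0.le hj1.le
      rw [hm] at m2
      have key : lft Q (j : ℝ) = x ∨ lft Q' (j : ℝ) = ((-x : ℤ) : ℝ) := by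
        by_contra! hcon
        apply hpi
        refine h.mem_interior m1 m2 (lt_of_le_of_ne l1 hcon.1) ?_ hj0 hj1
        have := lt_of_le_of_ne l2 (by simpa using hcon.2)
        linarith
    · rcases key with k | k
      · left; rw [k]; simp
      · right; rw [k, Int.floor_intCast]; simp
    · rcases key with k | k
      · rw [k]; simp
      · exact absurd ⟨_, k⟩ c2
    · rcases key with k | k
      · exact absurd ⟨_, k⟩ c1
      · rw [k, Int.floor_intCast]; simp
    · rcases key with k | k
      · exact absurd ⟨_, k⟩ c1
      · exact absurd ⟨_, k⟩ c2
  have hcard : boundaryLatticeCount Q ≤ T.card := by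
    have h1 := Set.ncard_le_ncard hsub (T.finite_toSet.image _)
    have h2 := Set.ncard_image_le (f := F) T.finite_toSet
    rw [Set.ncard_coe_finset] at h2
    exact h1.trans h2
  have hend : ∀ j : ℕ, j = 0 ∨ j = n + 1 →
      ((brow Q Q' n j).card : ℝ) ≤ 1 - lft Q (j : ℝ) - lft Q' (j : ℝ) := by
    intro j hj
    unfold brow
    rw [if_pos hj, Int.card_Icc]
    have hj' : (j : ℝ) = 0 ∨ (j : ℝ) = ((n+1 : ℕ) : ℝ) := by
      rcases hj with rfl | rfl <;> simp
    obtain ⟨a, ha⟩ := h.lft_int (by omega) hj'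
    obtain ⟨b, hb⟩ := h'.lft_int (by omega) hj'
    have hj0 : (0:ℝ) ≤ j := by positivity
    have hj1 : (j:ℝ) ≤ (n+1 : ℕ) := by exact_mod_cast (by omega : j ≤ n+1)
    have m2 := h'.lft_mem (by omega) hj0 hj1
    rw [hm] at m2
    have := h.lft_le m2
    rw [ha, hb] at this ⊢
    have hab : a ≤ -b := by exact_mod_cast this
    rw [Int.floor_intCast, Int.floor_intCast]
    have : (((-b + 1 - a).toNat : ℤ)) = 1 - a - b := by
      rw [Int.toNat_of_nonneg (by omega)]; ring
    have h3 : (((-b + 1 - a).toNat : ℤ) : ℝ) = ((1 - a - b : ℤ) : ℝ) := by rw [this]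
    push_cast at h3
    exact h3.le
  have hmid : ∀ k < n, (brow Q Q' n (k+1)).card + defect Q k + defect Q' k ≤ 2 := by
    intro k hk
    unfold brow defect
    rw [if_neg (by omega)]
    split_ifs
    · exact (Nat.add_le_add_right (Nat.add_le_add_right (Finset.card_union_le _ _) _) _)
    all_goals simp
  have hT : T.card = (brow Q Q' n 0).card + ∑ k ∈ Finset.range n, (brow Q Q' n (k+1)).card
      + (brow Q Q' n (n+1)).card := by
    rw [Finset.card_sigma, Finset.sum_range_succ, Finset.sum_range_succ']
    ring
  have hsum : ∑ k ∈ Finset.range n, (brow Q Q' n (k+1)).card + ∑ k ∈ Finset.range n, defect Q k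
      + ∑ k ∈ Finset.range n, defect Q' k ≤ 2 * n := by
    rw [← Finset.sum_add_distrib, ← Finset.sum_add_distrib]
    refine (Finset.sum_le_card_nsmul _ _ 2 (fun k hk => hmid k (Finset.mem_range.1 hk))).trans ?_
    simp [mul_comm]
  have e0 := hend 0 (Or.inl rfl)
  have e1 := hend (n+1) (Or.inr rfl)
  have hc' : (boundaryLatticeCount Q : ℝ) ≤ (brow Q Q' n 0).card +
      ((∑ k ∈ Finset.range n, (brow Q Q' n (k+1)).card : ℕ) : ℝ) + (brow Q Q' n (n+1)).card := by
    rw [hT] at hcard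
    exact_mod_cast hcard
  have hs' : ((∑ k ∈ Finset.range n, (brow Q Q' n (k+1)).card : ℕ) : ℝ)
      + ((∑ k ∈ Finset.range n, defect Q k : ℕ) : ℝ)
      + ((∑ k ∈ Finset.range n, defect Q' k : ℕ) : ℝ) ≤ 2 * n := by exact_mod_cast hsum
  linarith

lemma Good.main {Q n} (h : Good Q (n+1)) :
    (n : ℝ) * (boundaryLatticeCount Q : ℝ) ≤
      n * columnVectorCount Q + 2 * polygonGenus Q + 2 * n * (n + 1) := by
  obtain ⟨Q', h', hm, hcol⟩ := h.mirror
  have hg := h.genus_ge h' hm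
  have hb := h.bdry_le h' hm
  have hfin : {v : ℤ × ℤ | IsColumnVector Q v}.Finite := by
    obtain ⟨S, hS, -⟩ := h.poly
    exact finite_col S hS h.two
  have s1 := h.side
  have s2 := h'.side
  have n1 := h.side_nonneg
  have n2 := h'.side_nonneg
  have c1 : IsColumnVector Q (-1, 0) → 1 ≤ columnVectorCount Q := by
    intro hc
    exact (Set.ncard_pos hfin).2 ⟨_, hc⟩
  have c2 : IsColumnVector Q' (-1, 0) → 1 ≤ columnVectorCount Q := by
    intro hc
    exact (Set.ncard_pos hfin).2 ⟨_, hcol hc⟩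
  have c12 : IsColumnVector Q (-1, 0) → IsColumnVector Q' (-1, 0) →
      2 ≤ columnVectorCount Q := by
    intro ha hb
    have : ({((-1 : ℤ), (0 : ℤ)), (1, 0)} : Set (ℤ × ℤ)) ⊆ {v : ℤ × ℤ | IsColumnVector Q v} := by
      rintro v (rfl | rfl)
      · exact ha
      · exact hcol hb
    have h2 := Set.ncard_le_ncard this hfin
    rwa [Set.ncard_pair (by simp)] at h2
  have hc0 : (0:ℝ) ≤ columnVectorCount Q := by positivity
  simp only [Finset.sum_sub_distrib, Finset.sum_neg_distrib, Finset.sum_const, Finset.card_range,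
    nsmul_eq_mul, mul_one] at hg
  set D := ∑ k ∈ Finset.range n, defect Q k
  set D' := ∑ k ∈ Finset.range n, defect Q' k
  have hD : (0:ℝ) ≤ D := by positivity
  have hD' : (0:ℝ) ≤ D' := by positivity
  generalize ∑ k ∈ Finset.range n, (⌊lft Q ((k+1 : ℕ) : ℝ)⌋ : ℝ) = X at *
  generalize ∑ k ∈ Finset.range n, (⌊lft Q' ((k+1 : ℕ) : ℝ)⌋ : ℝ) = X' at *
  generalize lft Q ((0 : ℕ) : ℝ) + lft Q ((n+1 : ℕ) : ℝ) = Y at *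
  generalize lft Q' ((0 : ℕ) : ℝ) + lft Q' ((n+1 : ℕ) : ℝ) = Y' at *
  have hn : (0:ℝ) ≤ n := by positivity
  have hb' := mul_le_mul_of_nonneg_left hb hn
  suffices hs : 2 * (n:ℝ) ≤ n * D + n * D' + n * columnVectorCount Q +
      (n * Y - 2 * X) + (n * Y' - 2 * X') by nlinarith
  have pD := mul_nonneg hn hD
  have pD' := mul_nonneg hn hD'
  have pc := mul_nonneg hn hc0
  have toR : ∀ (a b : ℕ), a ≤ b → (n : ℝ) * a ≤ n * b := by
    intro a b hab
    exact mul_le_mul_of_nonneg_left (by exact_mod_cast hab) hn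
  rcases s1 with a | a | a <;> rcases s2 with b | b | b
  · have := toR _ _ a; have := toR _ _ b; push_cast at *; linarith
  · have := toR _ _ a; have := toR _ _ (c2 b); push_cast at *; linarith
  · have := toR _ _ a; push_cast at *; linarith
  · have := toR _ _ (c1 a); have := toR _ _ b; push_cast at *; linarith
  · have := toR _ _ (c12 a b); push_cast at *; linarith
  · have := toR _ _ (c1 a); push_cast at *; linarith
  · have := toR _ _ b; push_cast at *; linarith
  · have := toR _ _ (c2 b); push_cast at *; linarith
  · linarith

lemma exists_good (P : Set (ℝ × ℝ)) (d : ℕ) (hP : IsLatticePolygon P)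
    (h2 : (interior P).Nonempty) (hlw : LatticeWidthIs P d) :
    ∃ Φ e L, ZT Φ e L ∧ Good (Φ '' P) d := by
  obtain ⟨⟨hd, φ, ⟨a, b, c, d', e, f, hdet, hφ⟩, hstrip⟩, hmin⟩ := hlw
  obtain ⟨Φ, E, L, hz, hΦ, -⟩ := exists_ZT a b c d' e f hdet
  obtain ⟨S, hSne, hS⟩ := hP
  refine ⟨Φ, E, L, hz, ⟨S.map E.toEmbedding, by rw [hS]; exact image_poly hz S, ?_, ?_, ?_⟩,
    by rw [image_interior]; exact h2.image _⟩
  all_goals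
    have hSP : ∀ s ∈ S, latticeEmbed s ∈ P := by
      intro s hs; rw [hS]; exact subset_convexHull _ _ ⟨s, hs, rfl⟩
    have hE : ∀ s, (((E s).2 : ℤ) : ℝ) = c * s.1 + d' * s.2 + f := by
      intro s
      have := congrArg Prod.snd (hz.emb s)
      rw [hΦ] at this
      simpa [latticeEmbed] using this
    have hb : ∀ s ∈ S, 0 ≤ (E s).2 ∧ (E s).2 ≤ d := by
      intro s hs
      have h1 := hstrip ⟨_, hSP s hs, rfl⟩
      rw [hφ] at h1
      have h3 : (0:ℝ) ≤ (((E s).2 : ℤ) : ℝ) ∧ (((E s).2 : ℤ) : ℝ) ≤ d := by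
        rw [hE]; exact h1
      exact_mod_cast h3
    -- key: a shrunken strip is impossible
    have key : ∀ t : ℤ, 0 ≤ t → t ≤ 1 → (∀ s ∈ S, 0 ≤ (E s).2 - t ∧ (E s).2 - t ≤ d - 1) → False := by
      intro t _ _ hs
      have hall : ∀ p ∈ P, 0 ≤ (c : ℝ) * p.1 + d' * p.2 + (f - t) ∧
          (c : ℝ) * p.1 + d' * p.2 + (f - t) ≤ d - 1 := by
        have hconv : Convex ℝ {p : ℝ × ℝ | 0 ≤ (c : ℝ) * p.1 + d' * p.2 + (f - t) ∧
          (c : ℝ) * p.1 + d' * p.2 + (f - t) ≤ d - 1} := by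
          rintro ⟨x, y⟩ ⟨h1, h2⟩ ⟨x', y'⟩ ⟨h3, h4⟩ u v hu hv huv
          simp only [mem_ofPred_eq, Prod.fst_add, Prod.smul_fst, Prod.snd_add, Prod.smul_snd,
            smul_eq_mul] at *
          have hv' : v = 1 - u := by linarith
          subst hv'
          constructor <;> nlinarith
        intro p hp
        rw [hS] at hp
        refine convexHull_min ?_ hconv hp
        rintro _ ⟨s, hs', rfl⟩
        have h1 := hs s hs'
        have h3 : (0:ℝ) ≤ (((E s).2 : ℤ) : ℝ) - t ∧ (((E s).2 : ℤ) : ℝ) - t ≤ d - 1 := by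
          exact_mod_cast h1
        rw [hE] at h3
        simp only [mem_ofPred_eq, latticeEmbed]
        constructor <;> linarith [h3.1, h3.2]
      rcases Nat.lt_or_ge 1 d with hd1 | hd1
      · have hmem : d - 1 ∈ {s : ℕ | 0 < s ∧ ∃ φ, IsZAffine φ ∧ φ '' P ⊆ strip (s : ℝ)} := by
          refine ⟨by omega, fun p => ((a : ℝ) * p.1 + (b : ℝ) * p.2 + (e : ℝ),
             (c : ℝ) * p.1 + (d' : ℝ) * p.2 + ((f - t : ℤ) : ℝ)),
             ⟨a, b, c, d', e, f - t, hdet, fun p => rfl⟩, ?_⟩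
          rintro _ ⟨p, hp, rfl⟩
          have := hall p hp
          simp only [strip, mem_ofPred_eq]
          push_cast [Nat.cast_sub hd1.le]
          exact this
        have := hmin hmem
        omega
      · have hd1 : d = 1 := by omega
        subst hd1
        obtain ⟨z, hz'⟩ := h2
        -- the polygon lies on a line
        have hz2 : Φ z ∈ interior (Φ '' P) := by
          rw [image_interior]; exact ⟨z, hz', rfl⟩
        have hline : Φ '' P ⊆ (Set.univ : Set ℝ) ×ˢ ({(t : ℝ)} : Set ℝ) := by
          rintro _ ⟨p, hp, rfl⟩
          have h1 := hall p hp
          rw [hΦ]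
          refine ⟨trivial, ?_⟩
          simp only [mem_singleton_iff]
          push_cast at h1
          linarith [h1.1, h1.2]
        have h3 := interior_mono hline hz2
        rw [interior_prod_eq] at h3
        simp at h3
  · intro q hq
    obtain ⟨p, hp, rfl⟩ := Finset.mem_map.1 hq
    exact hb p hp
  · by_contra! hcon
    refine key 1 (by norm_num) le_rfl (fun s hs => ?_)
    have h1 := hcon (E s) (Finset.mem_map.2 ⟨s, hs, rfl⟩)
    have h3 := hb s hs
    omega
  · by_contra! hcon
    refine key 0 le_rfl (by norm_num) (fun s hs => ?_)
    have h1 := hcon (E s) (Finset.mem_map.2 ⟨s, hs, rfl⟩)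
    have h3 := hb s hs
    omega

/-- For a maximal non-hyperelliptic lattice polygon `P` of lattice width `d > 1`
with `g` interior lattice points, `g + r(P) − 3 − c(P) ≤ g + 2g/(d−1) + 2d − 3`. -/
theorem stmt0 (P : Set (ℝ × ℝ)) (d : ℕ)
    (hP : IsMaximalPolygon P) (hnh : NonHyperelliptic P)
    (hlw : LatticeWidthIs P d) (hd : 1 < d) :
    (polygonGenus P : ℝ) + (boundaryLatticeCount P : ℝ) - 3 - (columnVectorCount P : ℝ) ≤
      (polygonGenus P : ℝ) + 2 * (polygonGenus P : ℝ) / ((d : ℝ) - 1) + 2 * (d : ℝ) - 3 := by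
  obtain ⟨hpoly, -⟩ := hP
  have h2 : (interior P).Nonempty := by
    refine hnh.mono (interior_mono ?_)
    obtain ⟨S, -, hS⟩ := hpoly
    refine convexHull_min ?_ (poly_convex_compact S hS).1
    rintro _ ⟨p, hp, rfl⟩
    exact interior_subset hp
  obtain ⟨Φ, e, L, hz, hg⟩ := exists_good P d hpoly h2 hlw
  obtain ⟨n, rfl⟩ : ∃ n, d = n + 1 := ⟨d - 1, by omega⟩
  have hmain := hg.main
  have e1 : polygonGenus (Φ '' P) = polygonGenus P := by
    have := hz.ncard (interior P)
    rw [← image_interior] at this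
    exact this
  have e2 : boundaryLatticeCount (Φ '' P) = boundaryLatticeCount P := by
    have := hz.ncard (frontier P)
    rw [← image_frontier] at this
    exact this
  have e3 : columnVectorCount (Φ '' P) ≤ columnVectorCount P := by
    obtain ⟨S, -, hS⟩ := hpoly
    refine Set.ncard_le_ncard_of_injOn L.symm ?_ L.symm.injective.injOn (finite_col S hS h2)
    intro v hv
    exact hz.col (by simpa using hv)
  rw [e1, e2] at hmain
  have e3' : (columnVectorCount (Φ '' P) : ℝ) ≤ columnVectorCount P := by exact_mod_cast e3
  have hn : (0:ℝ) < n := by exact_mod_cast (by omega : 0 < n)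
  have h4 : (n : ℝ) * columnVectorCount (Φ '' P) ≤ n * columnVectorCount P :=
    mul_le_mul_of_nonneg_left e3' hn.le
  have h5 : (boundaryLatticeCount P : ℝ) - columnVectorCount P - 2 * (n + 1) ≤
      2 * (polygonGenus P : ℝ) / n := by
    rw [le_div_iff₀ hn]
    nlinarith
  push_cast
  rw [add_sub_cancel_right]
  linarith
end

section
/- Let P be a maximal non-hyperelliptic lattice polygon with g interior lattice points, r(P) boundary lattice points, c(P) column vectors, and expected gonality egon(P) = d (so d ≥ 3). Then g + r(P) − 3 − c(P) ≤ g + 2g/(d − 1) + 2d − 3. -/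
open Set

lemma latticeEmbed_inj : Function.Injective latticeEmbed := by
  rintro ⟨a, b⟩ ⟨c, d⟩ h
  simp only [latticeEmbed, Prod.mk.injEq, Int.cast_inj] at h
  ext <;> simp [h.1, h.2]

lemma zaff_pack {φ : ℝ × ℝ → ℝ × ℝ} (h : IsZAffine φ) :
    ∃ (e : (ℝ × ℝ) ≃ᵃ[ℝ] (ℝ × ℝ)) (t : (ℤ × ℤ) ≃ (ℤ × ℤ)) (m : ℤ × ℤ → ℤ × ℤ),
      (⇑e = φ) ∧ IsZAffine e.symm ∧ (∀ p, φ (latticeEmbed p) = latticeEmbed (t p)) ∧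
      (∀ p v, t (p + v) = t p + m v) ∧ Function.Injective m ∧ m 0 = 0 := by
  obtain ⟨a, b, c, d, e, f, hD, hφ⟩ := h
  obtain ⟨D, hD1, hD2⟩ : ∃ D : ℤ, D * (a * d - b * c) = 1 ∧ (D = 1 ∨ D = -1) := by
    rcases hD with h | h
    · exact ⟨1, by rw [h]; rfl, Or.inl rfl⟩
    · exact ⟨-1, by rw [h]; rfl, Or.inr rfl⟩
  have hDr : (D : ℝ) * ((a : ℝ) * d - b * c) = 1 := by exact_mod_cast hD1
  let lin : (ℝ × ℝ) ≃ₗ[ℝ] (ℝ × ℝ) :=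
    { toFun := fun p => ((a : ℝ) * p.1 + b * p.2, (c : ℝ) * p.1 + d * p.2)
      invFun := fun p => ((D : ℝ) * (d * p.1 - b * p.2), (D : ℝ) * (a * p.2 - c * p.1))
      map_add' := by intro p q; ext <;> simp <;> ring
      map_smul' := by intro r q; ext <;> simp <;> ring
      left_inv := by
        intro p; ext <;> simp
        · linear_combination p.1 * hDr
        · linear_combination p.2 * hDr
      right_inv := by
        intro p; ext <;> simp
        · linear_combination p.1 * hDr
        · linear_combination p.2 * hDr }
  let e' : (ℝ × ℝ) ≃ᵃ[ℝ] (ℝ × ℝ) :=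
    { toFun := fun p => ((a : ℝ) * p.1 + b * p.2 + e, (c : ℝ) * p.1 + d * p.2 + f)
      invFun := fun p => ((D : ℝ) * (d * (p.1 - e) - b * (p.2 - f)),
        (D : ℝ) * (a * (p.2 - f) - c * (p.1 - e)))
      left_inv := by
        intro p; ext <;> simp
        · linear_combination p.1 * hDr
        · linear_combination p.2 * hDr
      right_inv := by
        intro p; ext <;> simp
        · linear_combination (p.1 - e) * hDr
        · linear_combination (p.2 - f) * hDr
      linear := lin
      map_vadd' := by intro p v; ext <;> simp [lin] <;> ring }
  let t : (ℤ × ℤ) ≃ (ℤ × ℤ) :=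
    { toFun := fun p => (a * p.1 + b * p.2 + e, c * p.1 + d * p.2 + f)
      invFun := fun p => (D * (d * (p.1 - e) - b * (p.2 - f)),
        D * (a * (p.2 - f) - c * (p.1 - e)))
      left_inv := by
        intro p; ext <;> simp
        · linear_combination p.1 * hD1
        · linear_combination p.2 * hD1
      right_inv := by
        intro p; ext <;> simp
        · linear_combination (p.1 - e) * hD1
        · linear_combination (p.2 - f) * hD1 }
  refine ⟨e', t, fun p => (a * p.1 + b * p.2, c * p.1 + d * p.2), ?_, ?_, ?_, ?_, ?_, ?_⟩
  · funext p; rw [hφ]; rfl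
  · refine ⟨D * d, -(D * b), -(D * c), D * a, -(D * (d * e - b * f)), -(D * (a * f - c * e)), ?_, ?_⟩
    · rcases hD2 with rfl | rfl
      · left; linarith
      · right; linarith
    · intro p
      change ((D : ℝ) * (d * (p.1 - e) - b * (p.2 - f)),
        (D : ℝ) * (a * (p.2 - f) - c * (p.1 - e))) = _
      push_cast
      ext <;> simp <;> ring
  · intro p; rw [hφ]; simp [latticeEmbed, t]
  · intro p v; ext <;> simp [t] <;> ring
  · rintro ⟨p1, p2⟩ ⟨q1, q2⟩ h
    simp only [Prod.mk.injEq] at h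
    obtain ⟨h1, h2⟩ := h
    ext
    · simp only; linear_combination D * d * h1 - D * b * h2 - (p1 - q1) * hD1
    · simp only; linear_combination -D * c * h1 + D * a * h2 - (p2 - q2) * hD1
  · simp

lemma zaff_comp {φ ψ : ℝ × ℝ → ℝ × ℝ} (h : IsZAffine φ) (k : IsZAffine ψ) :
    IsZAffine (φ ∘ ψ) := by
  obtain ⟨a, b, c, d, e, f, hD, hφ⟩ := h
  obtain ⟨a', b', c', d', e', f', hD', hψ⟩ := k
  refine ⟨a * a' + b * c', a * b' + b * d', c * a' + d * c', c * b' + d * d',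
    a * e' + b * f' + e, c * e' + d * f' + f, ?_, ?_⟩
  · have : (a * a' + b * c') * (c * b' + d * d') - (a * b' + b * d') * (c * a' + d * c')
      = (a * d - b * c) * (a' * d' - b' * c') := by ring
    rw [this]
    rcases hD with h | h <;> rcases hD' with h' | h' <;> simp [h, h']
  · intro p
    simp only [Function.comp, hφ, hψ]
    push_cast
    ext <;> simp <;> ring

/-- the homeomorphism of an affine equivalence of the plane -/
def affHomeo (e : (ℝ × ℝ) ≃ᵃ[ℝ] (ℝ × ℝ)) : (ℝ × ℝ) ≃ₜ (ℝ × ℝ) where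
  toEquiv := e.toEquiv
  continuous_toFun := AffineMap.continuous_of_finiteDimensional e.toAffineMap
  continuous_invFun := AffineMap.continuous_of_finiteDimensional e.symm.toAffineMap

lemma aff_interior (e : (ℝ × ℝ) ≃ᵃ[ℝ] (ℝ × ℝ)) (P : Set (ℝ × ℝ)) :
    interior (e '' P) = e '' interior P := ((affHomeo e).image_interior P).symm

lemma aff_frontier (e : (ℝ × ℝ) ≃ᵃ[ℝ] (ℝ × ℝ)) (P : Set (ℝ × ℝ)) :
    frontier (e '' P) = e '' frontier P := ((affHomeo e).image_frontier P).symm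

lemma isLatticePolygon_image {φ : ℝ × ℝ → ℝ × ℝ} (h : IsZAffine φ) {P : Set (ℝ × ℝ)}
    (hP : IsLatticePolygon P) : IsLatticePolygon (φ '' P) := by
  obtain ⟨e, t, m, he, -, ht, -⟩ := zaff_pack h
  obtain ⟨S, hS, rfl⟩ := hP
  refine ⟨S.map t.toEmbedding, by simpa using hS, ?_⟩
  rw [← he, show (⇑e '' convexHull ℝ (latticeEmbed '' (S : Set (ℤ × ℤ)))) =
    convexHull ℝ (⇑e '' (latticeEmbed '' (S : Set (ℤ × ℤ)))) from
      AffineMap.image_convexHull e.toAffineMap _, he]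
  congr 1
  simp only [Finset.coe_map, Set.image_image, Equiv.coe_toEmbedding, ht]

lemma preimage_set (t : (ℤ × ℤ) ≃ (ℤ × ℤ)) {e : (ℝ × ℝ) ≃ᵃ[ℝ] (ℝ × ℝ)}
    (ht : ∀ p, e (latticeEmbed p) = latticeEmbed (t p)) (A : Set (ℝ × ℝ)) :
    {p : ℤ × ℤ | latticeEmbed p ∈ e '' A} = t '' {p : ℤ × ℤ | latticeEmbed p ∈ A} := by
  ext p
  constructor
  · rintro ⟨x, hx, hxp⟩
    refine ⟨t.symm p, ?_, by simp⟩
    have : e (latticeEmbed (t.symm p)) = e x := by rw [ht, hxp]; simp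
    have := e.injective this
    simpa [this] using hx
  · rintro ⟨q, hq, rfl⟩
    exact ⟨_, hq, ht q⟩

lemma interiorLatticePoints_image {φ : ℝ × ℝ → ℝ × ℝ} (h : IsZAffine φ) (P : Set (ℝ × ℝ)) :
    ∃ t : (ℤ × ℤ) ≃ (ℤ × ℤ), (∀ p, φ (latticeEmbed p) = latticeEmbed (t p)) ∧
    interiorLatticePoints (φ '' P) = t '' interiorLatticePoints P := by
  obtain ⟨e, t, m, rfl, -, ht, -⟩ := zaff_pack h
  refine ⟨t, ht, ?_⟩
  rw [interiorLatticePoints, aff_interior, preimage_set t ht]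
  rfl

lemma genus_image {φ : ℝ × ℝ → ℝ × ℝ} (h : IsZAffine φ) (P : Set (ℝ × ℝ)) :
    polygonGenus (φ '' P) = polygonGenus P := by
  obtain ⟨t, -, ht⟩ := interiorLatticePoints_image h P
  rw [polygonGenus, ht, Set.ncard_image_of_injective _ t.injective, polygonGenus]

lemma boundary_image {φ : ℝ × ℝ → ℝ × ℝ} (h : IsZAffine φ) (P : Set (ℝ × ℝ)) :
    boundaryLatticeCount (φ '' P) = boundaryLatticeCount P := by
  obtain ⟨e, t, m, rfl, -, ht, -⟩ := zaff_pack h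
  rw [boundaryLatticeCount, aff_frontier, preimage_set t ht,
    Set.ncard_image_of_injective _ t.injective, boundaryLatticeCount]

lemma isEdge_image (e : (ℝ × ℝ) ≃ᵃ[ℝ] (ℝ × ℝ)) {P τ : Set (ℝ × ℝ)} (h : IsEdge P τ) :
    IsEdge (e '' P) (e '' τ) := by
  obtain ⟨h1, h2⟩ := h
  constructor
  · intro hne
    obtain ⟨l, hl⟩ := h1 (by simpa using hne)
    let M : (ℝ × ℝ) →L[ℝ] (ℝ × ℝ) := LinearMap.toContinuousLinearMap e.linear.symm.toLinearMap
    have key : ∀ x y, l.comp M (e y) - l.comp M (e x) = l y - l x := by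
      intro x y
      rw [← map_sub]
      have : M (e y - e x) = y - x := by
        change e.linear.symm (e y - e x) = y - x
        rw [LinearEquiv.symm_apply_eq]
        exact (e.toAffineMap.linearMap_vsub y x).symm
      rw [ContinuousLinearMap.comp_apply, this, map_sub]
    refine ⟨l.comp M, ?_⟩
    conv_lhs => rw [hl]
    ext z
    constructor
    · rintro ⟨x, ⟨hx, hx2⟩, rfl⟩
      refine ⟨⟨x, hx, rfl⟩, ?_⟩
      rintro _ ⟨y, hy, rfl⟩
      have := key x y
      have := hx2 y hy
      linarith
    · rintro ⟨⟨x, hx, rfl⟩, h2⟩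
      refine ⟨x, ⟨hx, fun y hy => ?_⟩, rfl⟩
      have := key x y
      have := h2 (e y) ⟨y, hy, rfl⟩
      linarith
  · have : vectorSpan ℝ (⇑e '' τ) = Submodule.map e.linear.toLinearMap (vectorSpan ℝ τ) :=
      (AffineMap.map_vectorSpan e.toAffineMap).symm
    rw [this, ← h2]
    exact LinearEquiv.finrank_map_eq e.linear _

lemma column_image_le {φ : ℝ × ℝ → ℝ × ℝ} (h : IsZAffine φ) (P : Set (ℝ × ℝ))
    (hfin : {v : ℤ × ℤ | IsColumnVector (φ '' P) v}.Finite) :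
    columnVectorCount P ≤ columnVectorCount (φ '' P) := by
  obtain ⟨e, t, m, rfl, -, ht, htm, hm, hm0⟩ := zaff_pack h
  refine Set.ncard_le_ncard_of_injOn m ?_ hm.injOn hfin
  rintro v ⟨hv, τ, hτ, hv2⟩
  refine ⟨fun h => hv (hm (h.trans hm0.symm)), _, isEdge_image e hτ, ?_⟩
  intro p hp
  rw [← Set.image_sdiff e.injective] at hp
  have : p ∈ {p : ℤ × ℤ | latticeEmbed p ∈ e '' (P \ τ)} := hp
  rw [preimage_set t ht] at this
  obtain ⟨q, hq, rfl⟩ := this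
  rw [← htm, ← ht]
  exact ⟨_, hv2 q hq, rfl⟩

lemma image_symm_image (e : (ℝ × ℝ) ≃ᵃ[ℝ] (ℝ × ℝ)) (P : Set (ℝ × ℝ)) :
    e.symm '' (e '' P) = P := by
  rw [Set.image_image]; simp

lemma image_image_symm (e : (ℝ × ℝ) ≃ᵃ[ℝ] (ℝ × ℝ)) (P : Set (ℝ × ℝ)) :
    e '' (e.symm '' P) = P := by
  rw [Set.image_image]; simp

lemma maximal_image {φ : ℝ × ℝ → ℝ × ℝ} (h : IsZAffine φ) {P : Set (ℝ × ℝ)}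
    (hP : IsMaximalPolygon P) : IsMaximalPolygon (φ '' P) := by
  refine ⟨isLatticePolygon_image h hP.1, ?_⟩
  intro Q hQ hPQ hI
  obtain ⟨e, t, m, rfl, hs, ht, -⟩ := zaff_pack h
  have := hP.2 (e.symm '' Q) (isLatticePolygon_image hs hQ) ?_ ?_
  · rw [← this, image_image_symm]
  · rw [← image_symm_image e P]; exact Set.image_mono hPQ
  · rw [interiorLatticePoints] at hI
    obtain ⟨u, -, hu⟩ := interiorLatticePoints_image hs Q
    obtain ⟨u', hu'1, hu'2⟩ := interiorLatticePoints_image hs (e '' P)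
    have h3 : interiorLatticePoints Q = interiorLatticePoints (e '' P) := hI
    ext p
    have h4 : ∀ p A, p ∈ interiorLatticePoints (e.symm '' A) ↔ t p ∈ interiorLatticePoints A := by
      intro p A
      simp only [interiorLatticePoints, Set.mem_ofPred_eq, aff_interior, ← ht]
      constructor
      · rintro ⟨x, hx, hx2⟩
        rw [← hx2]; simpa using hx
      · intro hx
        exact ⟨_, hx, by simp⟩
    rw [h4, h3, ← h4, image_symm_image]

lemma polygon_convex {P : Set (ℝ × ℝ)} (hP : IsLatticePolygon P) : Convex ℝ P := by
  obtain ⟨S, -, rfl⟩ := hP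
  exact convex_convexHull _ _

lemma polygon_compact {P : Set (ℝ × ℝ)} (hP : IsLatticePolygon P) : IsCompact P := by
  obtain ⟨S, -, rfl⟩ := hP
  exact (S.finite_toSet.image _).isCompact_convexHull ℝ

lemma polygon_halfplane {P : Set (ℝ × ℝ)} (hP : IsLatticePolygon P) (α β γ : ℝ)
    (h : ∀ p : ℤ × ℤ, latticeEmbed p ∈ P → α * p.1 + β * p.2 ≤ γ) :
    ∀ q ∈ P, α * q.1 + β * q.2 ≤ γ := by
  obtain ⟨S, -, rfl⟩ := hP
  have hc : Convex ℝ {q : ℝ × ℝ | α * q.1 + β * q.2 ≤ γ} := by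
    intro x hx y hy a b ha hb hab
    simp only [Set.mem_ofPred_eq, Prod.fst_add, Prod.snd_add, Prod.smul_fst, Prod.smul_snd,
      smul_eq_mul] at *
    have h1 := mul_le_mul_of_nonneg_left hx ha
    have h2 := mul_le_mul_of_nonneg_left hy hb
    have h3 : a * γ + b * γ = γ := by rw [← add_mul, hab, one_mul]
    nlinarith
  intro q hq
  refine convexHull_min ?_ hc hq
  rintro _ ⟨p, hp, rfl⟩
  exact h p (subset_convexHull ℝ _ ⟨p, hp, rfl⟩)

lemma lattice_finite {P : Set (ℝ × ℝ)} (hP : IsLatticePolygon P) :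
    {p : ℤ × ℤ | latticeEmbed p ∈ P}.Finite := by
  obtain ⟨r, hr⟩ := (polygon_compact hP).isBounded.exists_norm_le
  refine Set.Finite.subset ((Set.finite_Icc (-⌈r⌉) ⌈r⌉).prod (Set.finite_Icc (-⌈r⌉) ⌈r⌉)) ?_
  intro p hp
  have h := hr _ hp
  rw [latticeEmbed, Prod.norm_def, sup_le_iff, Real.norm_eq_abs, Real.norm_eq_abs, abs_le,
    abs_le] at h
  have hc := Int.le_ceil r
  obtain ⟨⟨h1, h2⟩, h3, h4⟩ := h
  simp only at h1 h2 h3 h4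
  refine ⟨⟨?_, ?_⟩, ?_, ?_⟩
  · have : ((-⌈r⌉ : ℤ) : ℝ) ≤ p.1 := by push_cast; linarith
    exact_mod_cast this
  · have : (p.1 : ℝ) ≤ ⌈r⌉ := by linarith
    exact_mod_cast this
  · have : ((-⌈r⌉ : ℤ) : ℝ) ≤ p.2 := by push_cast; linarith
    exact_mod_cast this
  · have : (p.2 : ℝ) ≤ ⌈r⌉ := by linarith
    exact_mod_cast this

lemma interior_lattice_finite {P : Set (ℝ × ℝ)} (hP : IsLatticePolygon P) :
    (interiorLatticePoints P).Finite :=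
  (lattice_finite hP).subset fun _ hp => (interior_subset hp : _ ∈ P)

lemma clm_apply (f : (ℝ × ℝ) →L[ℝ] ℝ) (p : ℝ × ℝ) : f p = f (1, 0) * p.1 + f (0, 1) * p.2 := by
  have : p = p.1 • ((1 : ℝ), (0 : ℝ)) + p.2 • ((0 : ℝ), (1 : ℝ)) := by ext <;> simp
  conv_lhs => rw [this]
  rw [map_add, map_smul, map_smul]; simp; ring

/-- interior criterion -/
lemma mem_interior_of {P : Set (ℝ × ℝ)} (hP : Convex ℝ P) (hne : (interior P).Nonempty)
    {x y x1 x2 a1 y1 a2 y2 : ℝ} (h1 : (x1, y) ∈ P) (h2 : (x2, y) ∈ P) (h3 : (a1, y1) ∈ P)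
    (h4 : (a2, y2) ∈ P) (hx1 : x1 < x) (hx2 : x < x2) (hy1 : y1 < y) (hy2 : y < y2) :
    (x, y) ∈ interior P := by
  by_contra hcon
  obtain ⟨f, hf⟩ := geometric_hahn_banach_open_point hP.interior isOpen_interior hcon
  have hf2 : ∀ q ∈ P, f q ≤ f (x, y) := by
    intro q hq
    have hq' : q ∈ closure (interior P) := by
      rw [hP.closure_interior_eq_closure_of_nonempty_interior hne]
      exact subset_closure hq
    have : closure (interior P) ⊆ {q | f q ≤ f (x, y)} :=
      closure_minimal (fun a ha => (hf a ha).le) (isClosed_le f.continuous continuous_const)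
    exact this hq'
  obtain ⟨o, ho⟩ := hne
  have ho' := hf o ho
  have k1 := hf2 _ h1
  have k2 := hf2 _ h2
  have k3 := hf2 _ h3
  have k4 := hf2 _ h4
  rw [clm_apply f, clm_apply f (x, y)] at *
  set α := f (1, 0)
  set β := f (0, 1)
  simp only at *
  have hα : α = 0 := by
    apply le_antisymm
    · by_contra h; push Not at h; nlinarith
    · by_contra h; push Not at h; nlinarith
  rw [hα] at k3 k4 ho'
  have hβ : β = 0 := by
    apply le_antisymm
    · by_contra h; push Not at h; nlinarith
    · by_contra h; push Not at h; nlinarith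
  rw [hβ] at ho'
  simp at ho'

lemma interior_perturb {P : Set (ℝ × ℝ)} {q : ℝ × ℝ} (h : q ∈ interior P) (u v : ℝ) :
    ∃ ε > 0, q + (ε * u, ε * v) ∈ P := by
  have hc : ContinuousAt (fun ε : ℝ => q + (ε * u, ε * v)) 0 := by fun_prop
  have hn : P ∈ nhds (q + ((0 : ℝ) * u, (0 : ℝ) * v)) := by
    have : q + ((0 : ℝ) * u, (0 : ℝ) * v) = q := by ext <;> simp
    rw [this]; exact mem_interior_iff_mem_nhds.mp h
  have := hc.eventually_mem hn
  obtain ⟨ε, hε, hball⟩ := Metric.eventually_nhds_iff.mp this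
  refine ⟨ε / 2, by positivity, hball ?_⟩
  simp only [dist_zero_right, Real.norm_eq_abs]
  rw [abs_of_pos (by positivity)]; linarith

/-- a linear inequality on `P` is strict in the interior -/
lemma interior_strict {P : Set (ℝ × ℝ)} {α β γ : ℝ} (hne : α ≠ 0 ∨ β ≠ 0)
    (h : ∀ q ∈ P, α * q.1 + β * q.2 ≤ γ) {q : ℝ × ℝ} (hq : q ∈ interior P) :
    α * q.1 + β * q.2 < γ := by
  obtain ⟨ε, hε, hm⟩ := interior_perturb hq α β
  have := h _ hm
  simp only [Prod.fst_add, Prod.snd_add] at this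
  have h2 : 0 < α * α + β * β := by
    rcases hne with h | h
    · have := mul_self_pos.mpr h; have := mul_self_nonneg β; linarith
    · have := mul_self_pos.mpr h; have := mul_self_nonneg α; linarith
  nlinarith [mul_pos hε h2]

/-- exposing an edge by a linear functional -/
lemma isEdge_of {P : Set (ℝ × ℝ)} {α β γ : ℝ} (hne : α ≠ 0 ∨ β ≠ 0)
    (h : ∀ q ∈ P, α * q.1 + β * q.2 ≤ γ) {a b : ℝ × ℝ} (ha : a ∈ P) (hb : b ∈ P) (hab : a ≠ b)
    (ha' : α * a.1 + β * a.2 = γ) (hb' : α * b.1 + β * b.2 = γ) :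
    IsEdge P {q | q ∈ P ∧ α * q.1 + β * q.2 = γ} := by
  constructor
  · intro _
    refine ⟨α • ContinuousLinearMap.fst ℝ ℝ ℝ + β • ContinuousLinearMap.snd ℝ ℝ ℝ, ?_⟩
    ext q
    simp only [Set.mem_ofPred_eq, add_apply, smul_apply,
      ContinuousLinearMap.coe_fst', ContinuousLinearMap.coe_snd', smul_eq_mul]
    constructor
    · rintro ⟨hq, hq2⟩
      exact ⟨hq, fun y hy => by rw [hq2]; exact h y hy⟩
    · rintro ⟨hq, hq2⟩
      exact ⟨hq, le_antisymm (h q hq) (by rw [← ha']; exact hq2 a ha)⟩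
  · apply le_antisymm
    · have hle : vectorSpan ℝ {q | q ∈ P ∧ α * q.1 + β * q.2 = γ} ≤
          Submodule.span ℝ {(β, -α)} := by
        rw [vectorSpan_def, Submodule.span_le]
        rintro _ ⟨p, hp, q, hq, rfl⟩
        rw [SetLike.mem_coe, Submodule.mem_span_singleton]
        have e : α * (p.1 - q.1) + β * (p.2 - q.2) = 0 := by linarith [hp.2, hq.2]
        by_cases hα : α = 0
        · have hβ : β ≠ 0 := by tauto
          refine ⟨(p.1 - q.1) / β, ?_⟩
          rw [hα] at e ⊢
          have : p.2 - q.2 = 0 := by simpa [hβ] using e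
          ext
          · simp [hβ]
          · simp [this]
        · refine ⟨-(p.2 - q.2) / α, ?_⟩
          ext
          · simp; field_simp; linarith
          · simp; field_simp; ring
      exact (Submodule.finrank_mono hle).trans (finrank_span_singleton (by
        intro h0
        simp only [Prod.mk_eq_zero, neg_eq_zero] at h0
        tauto)).le
    · have hm : a -ᵥ b ∈ vectorSpan ℝ {q | q ∈ P ∧ α * q.1 + β * q.2 = γ} :=
        vsub_mem_vectorSpan ℝ ⟨ha, ha'⟩ ⟨hb, hb'⟩
      have : Submodule.span ℝ {a -ᵥ b} ≤ vectorSpan ℝ {q | q ∈ P ∧ α * q.1 + β * q.2 = γ} := by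
        rw [Submodule.span_le]; simpa using hm
      refine le_trans ?_ (Submodule.finrank_mono this)
      rw [finrank_span_singleton (by simpa [sub_eq_zero] using hab)]

lemma column_finite {P : Set (ℝ × ℝ)} (hP : IsLatticePolygon P) (hne : (interior P).Nonempty) :
    {v : ℤ × ℤ | IsColumnVector P v}.Finite := by
  have hF := lattice_finite hP
  refine ((hF.prod hF).image fun x => x.2 - x.1).subset ?_
  rintro v ⟨-, τ, hτ, hv⟩
  obtain ⟨p, hp⟩ : ∃ p : ℤ × ℤ, latticeEmbed p ∈ P \ τ := by
    by_contra hcon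
    push Not at hcon
    obtain ⟨hτ1, hτ2⟩ := hτ
    have hsub : P ⊆ τ := by
      have hc := hτ1.convex (polygon_convex hP)
      obtain ⟨S, hS, rfl⟩ := hP
      refine convexHull_min ?_ hc
      rintro _ ⟨p, hp, rfl⟩
      by_contra h
      exact hcon p ⟨subset_convexHull ℝ _ ⟨p, hp, rfl⟩, h⟩
    have h1 : vectorSpan ℝ P = ⊤ := by
      rw [← direction_affineSpan]
      rw [show affineSpan ℝ P = ⊤ from ?_]
      · simp
      · have := isOpen_interior.affineSpan_eq_top hne
        exact top_le_iff.mp (this ▸ affineSpan_mono ℝ interior_subset)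
    have h2 := vectorSpan_mono ℝ hsub
    rw [h1, top_le_iff] at h2
    rw [h2] at hτ2
    simp at hτ2
  exact ⟨(p, p + v), ⟨hp.1, hv p hp⟩, by simp⟩

/-- If the `σ`-side of the polygon is straight with lattice points in each row,
then `(σ, 0)` is a column vector. -/
lemma col_of {Q : Set (ℝ × ℝ)} (hc : Convex ℝ Q) (h : ℕ) (σ : ℤ) (hσ : σ * σ = 1)
    (hstrip : ∀ q ∈ Q, 0 ≤ q.2 ∧ q.2 ≤ h) (R : ℕ → ℝ) (A C : ℤ)
    (hR1 : ∀ j, 1 ≤ j → j < h → ((σ : ℝ) * R j, (j : ℝ)) ∈ Q)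
    (hR2 : ∀ j : ℕ, 1 ≤ j → j < h → ∀ x, (x, (j : ℝ)) ∈ Q → (σ : ℝ) * x ≤ R j)
    (hA1 : ((σ : ℝ) * A, (0 : ℝ)) ∈ Q) (hC1 : ((σ : ℝ) * C, (h : ℝ)) ∈ Q)
    (hA2 : ∀ p : ℤ × ℤ, latticeEmbed p ∈ Q → p.2 = 0 → σ * p.1 ≤ A)
    (hC2 : ∀ p : ℤ × ℤ, latticeEmbed p ∈ Q → p.2 = h → σ * p.1 ≤ C)
    (hz : ∀ j, 1 ≤ j → j < h → ∃ z : ℤ, R j = z)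
    (hlin : ∀ j : ℕ, 1 ≤ j → j < h → ((h : ℝ) - j) * A + j * C ≤ h * R j)
    (j : ℕ) (hj1 : 1 ≤ j) (hj2 : j < h) (hj : h * R j = ((h : ℝ) - j) * A + j * C) :
    IsColumnVector Q (σ, 0) := by
  have hσr : (σ : ℝ) * σ = 1 := by exact_mod_cast hσ
  have hσ0 : (σ : ℝ) ≠ 0 := fun h0 => by rw [h0] at hσr; simp at hσr
  have hjr : (1 : ℝ) ≤ j := by exact_mod_cast hj1
  have hjh : (j : ℝ) < h := by exact_mod_cast hj2
  have hh : (0 : ℝ) < h := by linarith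
  have hall : ∀ q ∈ Q, (h * σ : ℝ) * q.1 + (-(C - A) : ℝ) * q.2 ≤ h * A := by
    intro q hq
    by_contra hcon
    push Not at hcon
    obtain ⟨hy0, hyh⟩ := hstrip q hq
    rcases lt_or_ge (j : ℝ) q.2 with hy | hy
    · have hypos : 0 < q.2 := by linarith
      obtain ⟨t, ht⟩ : ∃ t : ℝ, t * q.2 = j := ⟨j / q.2, by field_simp⟩
      have ht0 : 0 < t := by
        by_contra h0; push Not at h0; nlinarith
      have ht1 : t < 1 := by
        by_contra h0; push Not at h0; nlinarith
      have hm := hc hq hA1 ht0.le (by linarith : 0 ≤ 1 - t) (by ring)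
      have e : t • q + (1 - t) • ((σ : ℝ) * A, (0 : ℝ)) =
        (t * q.1 + (1 - t) * (σ * A), (j : ℝ)) := by ext <;> simp [ht]
      rw [e] at hm
      have h1 := hR2 j hj1 hj2 _ hm
      have h2 := mul_lt_mul_of_pos_left hcon ht0
      have h3 := mul_le_mul_of_nonneg_left h1 hh.le
      rw [hj] at h3
      have e2 : (h : ℝ) * (σ * (t * q.1 + (1 - t) * (σ * A))) =
        t * (h * σ * q.1) + (1 - t) * h * A * (σ * σ) := by ring
      rw [e2, hσr] at h3
      have e3 : (C - A : ℝ) * (t * q.2) = (C - A) * j := by rw [ht]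
      nlinarith
    · have hypos : 0 < h - q.2 := by linarith
      obtain ⟨t, ht⟩ : ∃ t : ℝ, t * (h - q.2) = h - j := ⟨(h - j) / (h - q.2), by field_simp⟩
      have ht0 : 0 < t := by
        by_contra h0; push Not at h0; nlinarith
      have ht1 : t ≤ 1 := by
        by_contra h0; push Not at h0; nlinarith
      have hm := hc hq hC1 ht0.le (by linarith : 0 ≤ 1 - t) (by ring)
      have e : t • q + (1 - t) • ((σ : ℝ) * C, (h : ℝ)) =
        (t * q.1 + (1 - t) * (σ * C), (j : ℝ)) := by
          ext
          · simp
          · simp; linarith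
      rw [e] at hm
      have h1 := hR2 j hj1 hj2 _ hm
      have h2 := mul_lt_mul_of_pos_left hcon ht0
      have h3 := mul_le_mul_of_nonneg_left h1 hh.le
      rw [hj] at h3
      have e2 : (h : ℝ) * (σ * (t * q.1 + (1 - t) * (σ * C))) =
        t * (h * σ * q.1) + (1 - t) * h * C * (σ * σ) := by ring
      rw [e2, hσr] at h3
      have e3 : (C - A : ℝ) * (t * (h - q.2)) = (C - A) * (h - j) := by rw [ht]
      nlinarith
  have hne : (h * σ : ℝ) ≠ 0 := mul_ne_zero hh.ne' hσ0
  have hAe : (h * σ : ℝ) * (σ * A) + (-(C - A) : ℝ) * 0 = h * A := by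
    linear_combination (h * A : ℝ) * hσr
  have hCe : (h * σ : ℝ) * (σ * C) + (-(C - A) : ℝ) * h = h * A := by
    linear_combination (h * C : ℝ) * hσr
  refine ⟨?_, _, isEdge_of (Or.inl hne) hall hA1 hC1 ?_ hAe hCe, ?_⟩
  · intro h0
    simp only [Prod.mk_eq_zero, and_true] at h0
    rw [h0] at hσ0; simp at hσ0
  · intro h0
    have := congrArg Prod.snd h0
    simp only at this; linarith
  · rintro p ⟨hp, hpn⟩
    have hp2 := hstrip _ hp
    simp only [latticeEmbed] at hp2
    have h0 : 0 ≤ p.2 := by exact_mod_cast hp2.1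
    have h1 : p.2 ≤ h := by exact_mod_cast hp2.2
    obtain ⟨i, hi⟩ := Int.eq_ofNat_of_zero_le h0
    -- there is a lattice point of the edge in this row
    obtain ⟨z, hz1, hz2, hz3⟩ : ∃ z : ℤ, ((σ : ℝ) * z, (i : ℝ)) ∈ Q ∧ σ * p.1 ≤ z ∧
        (h : ℝ) * z = (h - i) * A + i * C := by
      rcases Nat.eq_zero_or_pos i with rfl | hi0
      · exact ⟨A, by simpa using hA1, hA2 p hp (by simpa using hi), by simp⟩
      · rcases lt_or_ge i h with hih | hih
        · obtain ⟨z, hz0⟩ := hz i hi0 hih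
          have hm := hR1 i hi0 hih
          rw [hz0] at hm
          refine ⟨z, hm, ?_, ?_⟩
          · have := hR2 i hi0 hih p.1 (by
              have := hp; rw [latticeEmbed, hi] at this; exact_mod_cast this)
            rw [hz0] at this
            exact_mod_cast this
          · have h3 := hlin i hi0 hih
            have h4 := hall _ hm
            simp only at h4
            rw [hz0] at h3
            have : (h * σ : ℝ) * (σ * z) = h * z := by linear_combination (h * z : ℝ) * hσr
            rw [this] at h4
            linarith
        · have hie : i = h := by omega
          subst hie
          exact ⟨C, hC1, hC2 p hp hi, by ring⟩
    have hne2 : σ * p.1 ≠ z := by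
      intro h5
      apply hpn
      refine ⟨hp, ?_⟩
      have h6 : (σ : ℝ) * p.1 = z := by exact_mod_cast h5
      have h7 : (p.2 : ℝ) = i := by rw [hi]; simp
      simp only [latticeEmbed]
      rw [mul_assoc, h6, h7, hz3]; ring
    have hlt : σ * p.1 + 1 ≤ z := by omega
    have hp' : ((p.1 : ℝ), (i : ℝ)) ∈ Q := by
      have := hp; rw [latticeEmbed, hi] at this; exact_mod_cast this
    have goal_eq : latticeEmbed (p + (σ, 0)) = ((p.1 : ℝ) + σ, (i : ℝ)) := by
      ext
      · simp [latticeEmbed]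
      · simp [latticeEmbed, hi]
    rw [goal_eq]
    have hltr : (σ : ℝ) * p.1 + 1 ≤ z := by exact_mod_cast hlt
    obtain ⟨t, ht⟩ : ∃ t : ℝ, t * (z - σ * p.1) = 1 :=
      ⟨1 / (z - σ * p.1), by rw [one_div, inv_mul_cancel₀]; linarith⟩
    have ht0 : 0 < t := by
      by_contra h0; push Not at h0; nlinarith
    have ht1 : t ≤ 1 := by
      by_contra h0; push Not at h0; nlinarith
    have hm := hc hz1 hp' ht0.le (by linarith : 0 ≤ 1 - t) (by ring)
    convert hm using 1
    ext
    · simp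
      linear_combination (-σ : ℝ) * ht + (-t * p.1) * hσr
    · simp; ring

lemma rs_lemma {Q : Set (ℝ × ℝ)} (hQ : IsLatticePolygon Q) (h : ℕ) (hh : 2 ≤ h) (σ : ℤ)
    (hσ : σ * σ = 1)
    (hstrip : ∀ q ∈ Q, 0 ≤ q.2 ∧ q.2 ≤ h)
    (hbot : ∃ p : ℤ × ℤ, latticeEmbed p ∈ Q ∧ p.2 = 0)
    (htop : ∃ p : ℤ × ℤ, latticeEmbed p ∈ Q ∧ p.2 = h) :
    ∃ (R : ℕ → ℝ) (A C κ : ℤ) (K : Finset ℕ),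
      (∀ j : ℕ, 1 ≤ j → j < h → ((σ : ℝ) * R j, (j : ℝ)) ∈ Q) ∧
      (∀ j : ℕ, 1 ≤ j → j < h → ∀ x, (x, (j : ℝ)) ∈ Q → (σ : ℝ) * x ≤ R j) ∧
      ((σ : ℝ) * A, (0 : ℝ)) ∈ Q ∧ ((σ : ℝ) * C, (h : ℝ)) ∈ Q ∧
      (∀ p : ℤ × ℤ, latticeEmbed p ∈ Q → p.2 = 0 → σ * p.1 ≤ A) ∧
      (∀ p : ℤ × ℤ, latticeEmbed p ∈ Q → p.2 = h → σ * p.1 ≤ C) ∧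
      (κ = 0 ∨ (κ = 1 ∧ IsColumnVector Q (σ, 0))) ∧
      (∀ j : ℕ, 1 ≤ j → j < h → (∃ z : ℤ, R j = z) → j ∈ K) ∧
      ((h : ℤ) - 1) * (A + C - κ - (h - 1) + K.card) ≤
        2 * ∑ j ∈ Finset.Ico 1 h, (⌈R j⌉ - 1) + (h - 1) := by
  classical
  have hσr : (σ : ℝ) * σ = 1 := by exact_mod_cast hσ
  have hc := polygon_convex hQ
  have hk := polygon_compact hQ
  have hhr : (2 : ℝ) ≤ h := by exact_mod_cast hh
  have hF := lattice_finite hQ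
  obtain ⟨p0, ⟨hp0, hp0'⟩, hp0m⟩ := Set.exists_max_image
    {p : ℤ × ℤ | latticeEmbed p ∈ Q ∧ p.2 = 0} (fun p => σ * p.1)
    (hF.subset fun p hp => hp.1) hbot
  obtain ⟨p1, ⟨hp1, hp1'⟩, hp1m⟩ := Set.exists_max_image
    {p : ℤ × ℤ | latticeEmbed p ∈ Q ∧ p.2 = h} (fun p => σ * p.1)
    (hF.subset fun p hp => hp.1) htop
  set A := σ * p0.1 with hA
  set C := σ * p1.1 with hC
  have hA1 : ((σ : ℝ) * A, (0 : ℝ)) ∈ Q := by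
    convert hp0 using 1
    ext
    · simp [hA, latticeEmbed, ← mul_assoc, hσr]
    · simp [latticeEmbed, hp0']
  have hC1 : ((σ : ℝ) * C, (h : ℝ)) ∈ Q := by
    convert hp1 using 1
    ext
    · simp [hC, latticeEmbed, ← mul_assoc, hσr]
    · simp [latticeEmbed, hp1']
  have hrow : ∀ j : ℕ, j < h → ((σ : ℝ) * ((((h : ℝ) - j) * A + j * C) / h), (j : ℝ)) ∈ Q := by
    intro j hj
    have hjr : (j : ℝ) < h := by exact_mod_cast hj
    have hm := hc hA1 hC1 (a := ((h : ℝ) - j) / h) (b := j / h)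
      (div_nonneg (by linarith) (by linarith)) (by positivity) (by field_simp; ring)
    convert hm using 1
    ext
    · simp; field_simp
    · simp; field_simp
  have hR : ∀ j : ℕ, ∃ r : ℝ, j < h → (((σ : ℝ) * r, (j : ℝ)) ∈ Q ∧
      ∀ x, (x, (j : ℝ)) ∈ Q → (σ : ℝ) * x ≤ r) := by
    intro j
    by_cases hj : j < h
    · have hcl : IsClosed {q : ℝ × ℝ | q.2 = j} := isClosed_eq continuous_snd continuous_const
      obtain ⟨q, ⟨hq1, hq2⟩, hq3⟩ := (hk.inter_right hcl).exists_isMaxOn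
        ⟨_, hrow j hj, rfl⟩ (f := fun q : ℝ × ℝ => (σ : ℝ) * q.1) (by fun_prop)
      refine ⟨σ * q.1, fun _ => ⟨?_, fun x hx => hq3 ⟨hx, rfl⟩⟩⟩
      convert hq1 using 1
      ext
      · simp [← mul_assoc, hσr]
      · exact hq2.symm
    · exact ⟨0, fun h0 => absurd h0 hj⟩
  choose R hR using hR
  have hlin : ∀ j : ℕ, 1 ≤ j → j < h → ((h : ℝ) - j) * A + j * C ≤ h * R j := by
    intro j _ hj
    have := (hR j hj).2 _ (hrow j hj)
    rw [← mul_assoc, hσr, one_mul, div_le_iff₀ (by linarith)] at this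
    linarith
  set K := (Finset.Ico 1 h).filter (fun j => ∃ z : ℤ, R j = z) with hK
  have hpair : ∀ j ∈ Finset.Ico 1 h, A + C ≤ ⌈R j⌉ + ⌈R (h - j)⌉ := by
    intro j hj
    rw [Finset.mem_Ico] at hj
    have h1 := hlin j hj.1 hj.2
    have h2 := hlin (h - j) (by omega) (by omega)
    rw [Nat.cast_sub hj.2.le] at h2
    have h3 := Int.le_ceil (R j)
    have h4 := Int.le_ceil (R (h - j))
    have h5 : (h : ℝ) * (A + C) ≤ h * (⌈R j⌉ + ⌈R (h - j)⌉) := by nlinarith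
    have h6 := le_of_mul_le_mul_left h5 (by linarith)
    exact_mod_cast h6
  have hrefl : ∑ j ∈ Finset.Ico 1 h, ⌈R (h - j)⌉ = ∑ j ∈ Finset.Ico 1 h, ⌈R j⌉ := by
    have := Finset.sum_Ico_reflect (fun j => ⌈R j⌉) 1 (m := h) (n := h) (by omega)
    simpa using this
  have hcard : ((Finset.Ico 1 h).card : ℤ) = h - 1 := by simp; omega
  have hsum : ∀ B : ℤ, (∀ j ∈ Finset.Ico 1 h, B ≤ ⌈R j⌉ + ⌈R (h - j)⌉) →
      ((h : ℤ) - 1) * B ≤ 2 * ∑ j ∈ Finset.Ico 1 h, ⌈R j⌉ := by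
    intro B hB
    have := Finset.sum_le_sum hB
    rw [Finset.sum_add_distrib, hrefl, Finset.sum_const, nsmul_eq_mul, hcard] at this
    linarith
  have hsplit : 2 * ∑ j ∈ Finset.Ico 1 h, (⌈R j⌉ - 1) + ((h : ℤ) - 1) =
      2 * ∑ j ∈ Finset.Ico 1 h, ⌈R j⌉ - (h - 1) := by
    rw [Finset.sum_sub_distrib, Finset.sum_const, nsmul_eq_mul, hcard]; ring
  have hKle : (K.card : ℤ) ≤ h - 1 := by
    rw [← hcard]; exact_mod_cast Finset.card_le_card (Finset.filter_subset _ _)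
  have hKmem : ∀ j : ℕ, 1 ≤ j → j < h → (∃ z : ℤ, R j = z) → j ∈ K := by
    intro j h1 h2 h3
    simp only [hK, Finset.mem_filter, Finset.mem_Ico]
    exact ⟨⟨h1, h2⟩, h3⟩
  have hn : (0 : ℤ) ≤ (h : ℤ) - 1 := by omega
  by_cases hcol : IsColumnVector Q (σ, 0)
  · refine ⟨R, A, C, 1, K, fun j _ hj => (hR j hj).1, fun j _ hj => (hR j hj).2, hA1, hC1,
      fun p h1 h2 => hp0m p ⟨h1, h2⟩, fun p h1 h2 => hp1m p ⟨h1, h2⟩, Or.inr ⟨rfl, hcol⟩, hKmem, ?_⟩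
    have := hsum _ hpair
    rw [hsplit]
    nlinarith
  · refine ⟨R, A, C, 0, K, fun j _ hj => (hR j hj).1, fun j _ hj => (hR j hj).2, hA1, hC1,
      fun p h1 h2 => hp0m p ⟨h1, h2⟩, fun p h1 h2 => hp1m p ⟨h1, h2⟩, Or.inl rfl, hKmem, ?_⟩
    rw [hsplit]
    by_cases hKc : (K.card : ℤ) = h - 1
    · have hall : ∀ j, 1 ≤ j → j < h → ∃ z : ℤ, R j = z := by
        have : K = Finset.Ico 1 h :=
          Finset.eq_of_subset_of_card_le (Finset.filter_subset _ _) (by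
            have : (K.card : ℤ) = (Finset.Ico 1 h).card := by rw [hKc, hcard]
            omega)
        intro j h1 h2
        have hj : j ∈ K := by rw [this]; exact Finset.mem_Ico.mpr ⟨h1, h2⟩
        exact (Finset.mem_filter.mp hj).2
      have := hsum (A + C + 1) ?_
      · rw [hKc]; nlinarith
      · intro j hj
        have hj' := Finset.mem_Ico.mp hj
        have h0 := hpair j hj
        by_contra hlt
        have heq : ⌈R j⌉ + ⌈R (h - j)⌉ = A + C := by omega
        apply hcol
        obtain ⟨z1, hz1⟩ := hall j hj'.1 hj'.2
        obtain ⟨z2, hz2⟩ := hall (h - j) (by omega) (by omega)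
        rw [hz1, hz2, Int.ceil_intCast, Int.ceil_intCast] at heq
        have heqr : R j + R (h - j) = A + C := by rw [hz1, hz2]; exact_mod_cast heq
        refine col_of hc h σ hσ hstrip R A C (fun j _ hj => (hR j hj).1)
          (fun j _ hj => (hR j hj).2) hA1 hC1
          (fun p h1 h2 => hp0m p ⟨h1, h2⟩) (fun p h1 h2 => hp1m p ⟨h1, h2⟩) hall hlin j
          hj'.1 hj'.2 ?_
        have h1 := hlin j hj'.1 hj'.2
        have h2 := hlin (h - j) (by omega) (by omega)
        rw [Nat.cast_sub hj'.2.le] at h2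
        have h3 : (h : ℝ) * (R j + R (h - j)) = h * (A + C) := by rw [heqr]
        linarith
    · have := hsum _ hpair
      have hK1 : (K.card : ℤ) ≤ h - 2 := by omega
      nlinarith

lemma row_lemma {Q : Set (ℝ × ℝ)} (hQ : IsLatticePolygon Q) (hne : (interior Q).Nonempty)
    (h : ℕ) (hh : 2 ≤ h)
    (hstrip : ∀ q ∈ Q, 0 ≤ q.2 ∧ q.2 ≤ h)
    (hbot : ∃ p : ℤ × ℤ, latticeEmbed p ∈ Q ∧ p.2 = 0)
    (htop : ∃ p : ℤ × ℤ, latticeEmbed p ∈ Q ∧ p.2 = h) :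
    ∃ F : Finset (ℤ × ℤ), (∀ v ∈ F, IsColumnVector Q v ∧ v.2 = 0) ∧
      ((h : ℤ) - 1) * (boundaryLatticeCount Q - F.card) ≤
        2 * polygonGenus Q + 2 * h * (h - 1) := by
  classical
  have hc := polygon_convex hQ
  obtain ⟨R, A, C, κ, K, hR1, hR2, hA1, hC1, hA2, hC2, hκ, hK, hmain⟩ :=
    rs_lemma hQ h hh 1 (by norm_num) hstrip hbot htop
  obtain ⟨R', A', C', κ', K', hR1', hR2', hA1', hC1', hA2', hC2', hκ', hK', hmain'⟩ :=
    rs_lemma hQ h hh (-1) (by norm_num) hstrip hbot htop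
  push_cast at *
  simp only [one_mul, neg_mul] at *
  have hAA : 0 ≤ A + A' := by
    obtain ⟨p, hp, hp'⟩ := hbot
    have := hA2 p hp hp'; have := hA2' p hp hp'; linarith
  have hCC : 0 ≤ C + C' := by
    obtain ⟨p, hp, hp'⟩ := htop
    have := hC2 p hp hp'; have := hC2' p hp hp'; linarith
  have hint : ∀ x : ℝ, ∀ j : ℕ, 1 ≤ j → j < h → x < R j → -x < R' j →
      (x, (j : ℝ)) ∈ interior Q := by
    intro x j h1 h2 h3 h4
    exact mem_interior_of hc hne (hR1' j h1 h2) (hR1 j h1 h2) hA1 hC1 (by linarith) h3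
      (by exact_mod_cast h1) (by exact_mod_cast h2)
  -- boundary count
  have hr : (boundaryLatticeCount Q : ℤ) ≤ (A + A' + 1) + (C + C' + 1) + K.card + K'.card := by
    let U : Finset (ℤ × ℤ) := (((Finset.Icc (-A') A) ×ˢ {0}) ∪ ((Finset.Icc (-C') C) ×ˢ {(h : ℤ)}))
      ∪ (K.image (fun j => (⌈R j⌉, (j : ℤ))) ∪ K'.image (fun j => (-⌈R' j⌉, (j : ℤ))))
    have hsub : {p : ℤ × ℤ | latticeEmbed p ∈ frontier Q} ⊆ (U : Set (ℤ × ℤ)) := by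
      intro p hp
      have hpQ : latticeEmbed p ∈ Q :=
        (polygon_compact hQ).isClosed.frontier_subset hp
      have hpI : latticeEmbed p ∉ interior Q := hp.2
      have hst := hstrip _ hpQ
      simp only [latticeEmbed] at hst
      have h0 : 0 ≤ p.2 := by exact_mod_cast hst.1
      have h1 : p.2 ≤ h := by exact_mod_cast hst.2
      obtain ⟨i, hi⟩ := Int.eq_ofNat_of_zero_le h0
      rw [Finset.mem_coe, Finset.mem_union, Finset.mem_union, Finset.mem_union]
      by_cases hp0 : p.2 = 0
      · left; left
        have := hA2 p hpQ hp0; have := hA2' p hpQ hp0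
        rw [Finset.mem_product, Finset.mem_Icc, Finset.mem_singleton]
        exact ⟨⟨by linarith, by linarith⟩, hp0⟩
      by_cases hph : p.2 = h
      · left; right
        have := hC2 p hpQ hph; have := hC2' p hpQ hph
        rw [Finset.mem_product, Finset.mem_Icc, Finset.mem_singleton]
        exact ⟨⟨by linarith, by linarith⟩, hph⟩
      right
      have hi1 : 1 ≤ i := by omega
      have hi2 : i < h := by omega
      have hpe : latticeEmbed p = ((p.1 : ℝ), (i : ℝ)) := by
        rw [latticeEmbed, hi]; simp
      rw [hpe] at hpQ hpI
      have k1 := hR2 i hi1 hi2 _ hpQ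
      have k2 := hR2' i hi1 hi2 _ hpQ
      by_cases e1 : (p.1 : ℝ) = R i
      · left
        rw [Finset.mem_image]
        refine ⟨i, hK i hi1 hi2 ⟨p.1, e1.symm⟩, ?_⟩
        rw [← e1]; ext <;> simp [hi]
      by_cases e2 : -(p.1 : ℝ) = R' i
      · right
        rw [Finset.mem_image]
        refine ⟨i, hK' i hi1 hi2 ⟨-p.1, by push_cast; exact e2.symm⟩, ?_⟩
        rw [← e2]; ext <;> simp [hi, Int.ceil_neg]
      exact absurd (hint p.1 i hi1 hi2 (lt_of_le_of_ne k1 e1) (lt_of_le_of_ne k2 e2)) hpI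
    have h1 : boundaryLatticeCount Q ≤ U.card := by
      rw [boundaryLatticeCount, ← Set.ncard_coe_finset U]
      exact Set.ncard_le_ncard hsub U.finite_toSet
    have h2 : U.card ≤ ((Finset.Icc (-A') A).card + (Finset.Icc (-C') C).card) +
        (K.card + K'.card) := by
      refine (Finset.card_union_le _ _).trans (add_le_add ((Finset.card_union_le _ _).trans ?_)
        ((Finset.card_union_le _ _).trans (add_le_add Finset.card_image_le Finset.card_image_le)))
      rw [Finset.card_product, Finset.card_product]; simp
    rw [Int.card_Icc, Int.card_Icc] at h2
    omega
  -- genus count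
  have hg : ∑ j ∈ Finset.Ico 1 h, ((⌈R j⌉ - 1) + (⌈R' j⌉ - 1) + 1) ≤ (polygonGenus Q : ℤ) := by
    let V : Finset (Σ _ : ℕ, ℤ) := (Finset.Ico 1 h).sigma
      (fun j => Finset.Icc (1 - ⌈R' j⌉) (⌈R j⌉ - 1))
    let f : (Σ _ : ℕ, ℤ) → ℤ × ℤ := fun s => (s.2, (s.1 : ℤ))
    have hf : Function.Injective f := by
      rintro ⟨a, b⟩ ⟨c, d⟩ h
      simp only [f, Prod.mk.injEq, Nat.cast_inj] at h
      rw [h.1, h.2]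
    have hsub : ((V.image f : Finset (ℤ × ℤ)) : Set (ℤ × ℤ)) ⊆ interiorLatticePoints Q := by
      intro p hp
      rw [Finset.mem_coe, Finset.mem_image] at hp
      obtain ⟨⟨j, x⟩, hs, rfl⟩ := hp
      rw [Finset.mem_sigma, Finset.mem_Ico, Finset.mem_Icc] at hs
      obtain ⟨⟨h1, h2⟩, h3, h4⟩ := hs
      simp only at h1 h2 h3 h4
      have := hint x j h1 h2 (Int.lt_ceil.mp (by omega)) (by
        have : ((-x : ℤ) : ℝ) < R' j := Int.lt_ceil.mp (by omega)
        push_cast at this; exact this)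
      simpa [interiorLatticePoints, latticeEmbed, f] using this
    have h1 : V.card ≤ polygonGenus Q := by
      rw [polygonGenus, ← Finset.card_image_of_injective V hf, ← Set.ncard_coe_finset]
      exact Set.ncard_le_ncard hsub (interior_lattice_finite hQ)
    have h2 : ∑ j ∈ Finset.Ico 1 h, ((⌈R j⌉ - 1) + (⌈R' j⌉ - 1) + 1) ≤ (V.card : ℤ) := by
      rw [Finset.card_sigma]
      push_cast
      refine Finset.sum_le_sum fun j _ => ?_
      rw [Int.card_Icc]
      omega
    exact h2.trans (by exact_mod_cast h1)
  have hcard : ((Finset.Ico 1 h).card : ℤ) = h - 1 := by simp; omega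
  rw [Finset.sum_add_distrib, Finset.sum_add_distrib, Finset.sum_const, nsmul_eq_mul, hcard] at hg
  have hn : (0 : ℤ) ≤ (h : ℤ) - 1 := by omega
  obtain ⟨F, hF, hFc⟩ : ∃ F : Finset (ℤ × ℤ), (∀ v ∈ F, IsColumnVector Q v ∧ v.2 = 0) ∧
      (F.card : ℤ) = κ + κ' := by
    rcases hκ with rfl | ⟨rfl, h1⟩ <;> rcases hκ' with rfl | ⟨rfl, h2⟩
    · exact ⟨∅, by simp, by simp⟩
    · exact ⟨{(-1, 0)}, by simpa using h2, by simp⟩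
    · exact ⟨{(1, 0)}, by simpa using h1, by simp⟩
    · refine ⟨{(1, 0), (-1, 0)}, ?_, by rw [Finset.card_pair (by simp)]; norm_num⟩
      intro v hv
      rw [Finset.mem_insert, Finset.mem_singleton] at hv
      rcases hv with rfl | rfl
      · exact ⟨h1, rfl⟩
      · exact ⟨h2, rfl⟩
  refine ⟨F, hF, ?_⟩
  rw [hFc]
  have := mul_le_mul_of_nonneg_left hr hn
  nlinarith

/-- the final inequality without division -/
def Concl (P : Set (ℝ × ℝ)) (w : ℕ) : Prop :=
  ((w : ℤ) + 1) * (boundaryLatticeCount P - columnVectorCount P) ≤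
    2 * polygonGenus P + 2 * (w + 2) * (w + 1)

/-- lattice width of the interior polygon is at least `w` -/
def LWP (P : Set (ℝ × ℝ)) (w : ℕ) : Prop :=
  ∀ χ, IsZAffine χ → ∀ s : ℕ, s < w → ∃ p ∈ interiorLatticePoints P, χ (latticeEmbed p) ∉ strip s

lemma concl_of_image {φ : ℝ × ℝ → ℝ × ℝ} (h : IsZAffine φ) {P : Set (ℝ × ℝ)} {w : ℕ}
    (hP : IsLatticePolygon P) (hne : (interior P).Nonempty)
    (hcon : Concl (φ '' P) w) : Concl P w := by
  obtain ⟨e, t, m, rfl, hs, -⟩ := zaff_pack h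
  have h1 := column_image_le hs (e '' P) (by rw [image_symm_image]; exact column_finite hP hne)
  rw [image_symm_image] at h1
  unfold Concl at *
  rw [boundary_image h, genus_image h] at hcon
  refine le_trans (mul_le_mul_of_nonneg_left ?_ (by positivity)) hcon
  omega

lemma lwp_image {φ : ℝ × ℝ → ℝ × ℝ} (h : IsZAffine φ) {P : Set (ℝ × ℝ)} {w : ℕ}
    (hP : LWP P w) : LWP (φ '' P) w := by
  intro χ hχ s hs
  obtain ⟨p, hp, hp2⟩ := hP _ (zaff_comp hχ h) s hs
  obtain ⟨t, ht, ht2⟩ := interiorLatticePoints_image h P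
  refine ⟨t p, by rw [ht2]; exact ⟨p, hp, rfl⟩, ?_⟩
  rw [← ht]; exact hp2

lemma tri_sum (w : ℕ) : 2 * ∑ x ∈ Finset.range (w + 1), (x + 1) = (w + 1) * (w + 2) := by
  induction w with
  | zero => simp
  | succ n ih => rw [Finset.sum_range_succ, mul_add, ih]; ring

lemma bary {Q : Set (ℝ × ℝ)} (hc : Convex ℝ Q) {p1 p2 u z : ℤ × ℤ}
    (h1 : p1 ∈ interiorLatticePoints Q) (h2 : p2 ∈ interiorLatticePoints Q)
    (hu : latticeEmbed u ∈ Q) (α β δ : ℤ) (hα : 0 ≤ α) (hβ : 0 ≤ β) (hδ : 0 ≤ δ)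
    (hαβ : 0 < α + β) (hx : (α + β + δ) * z.1 = α * p1.1 + β * p2.1 + δ * u.1)
    (hy : (α + β + δ) * z.2 = α * p1.2 + β * p2.2 + δ * u.2) :
    z ∈ interiorLatticePoints Q := by
  have hαr : (0 : ℝ) ≤ α := by exact_mod_cast hα
  have hβr : (0 : ℝ) ≤ β := by exact_mod_cast hβ
  have hδr : (0 : ℝ) ≤ δ := by exact_mod_cast hδ
  have hs : (0 : ℝ) < α + β := by exact_mod_cast hαβ
  have hN : (0 : ℝ) < α + β + δ := by linarith
  have hxr : ((α : ℝ) + β + δ) * z.1 = α * p1.1 + β * p2.1 + δ * u.1 := by exact_mod_cast hx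
  have hyr : ((α : ℝ) + β + δ) * z.2 = α * p1.2 + β * p2.2 + δ * u.2 := by exact_mod_cast hy
  have m1 := hc.interior h1 h2 (a := α / (α + β)) (b := β / (α + β)) (by positivity)
    (by positivity) (by field_simp)
  have m2 := hc.combo_interior_self_mem_interior m1 hu (a := (α + β) / (α + β + δ))
    (b := δ / (α + β + δ)) (by positivity) (by positivity) (by field_simp)
  change latticeEmbed z ∈ interior Q
  convert m2 using 1
  ext
  · simp [latticeEmbed]; field_simp; linarith
  · simp [latticeEmbed]; field_simp; linarith

/-- the triangle -/
def bigTri (w : ℕ) : Set (ℝ × ℝ) := {q | 0 ≤ q.2 ∧ q.1 ≤ 1 ∧ q.2 - w - 2 ≤ q.1}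

lemma bigTri_polygon (w : ℕ) : IsLatticePolygon (bigTri w) := by
  refine ⟨{(1, 0), (-(w : ℤ) - 2, 0), (1, (w : ℤ) + 3)}, by simp, ?_⟩
  apply Set.Subset.antisymm
  · rintro ⟨x, y⟩ ⟨h1, h2, h3⟩
    simp only at h1 h2 h3
    have hc := convex_convexHull ℝ (latticeEmbed ''
      (({(1, 0), (-(w : ℤ) - 2, 0), (1, (w : ℤ) + 3)} : Finset (ℤ × ℤ)) : Set (ℤ × ℤ)))
    have m1 : ((1 : ℝ), (0 : ℝ)) ∈ convexHull ℝ (latticeEmbed ''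
      (({(1, 0), (-(w : ℤ) - 2, 0), (1, (w : ℤ) + 3)} : Finset (ℤ × ℤ)) : Set (ℤ × ℤ))) :=
      subset_convexHull ℝ _ ⟨(1, 0), by simp, by simp [latticeEmbed]⟩
    have m2 : ((-w - 2 : ℝ), (0 : ℝ)) ∈ convexHull ℝ (latticeEmbed ''
      (({(1, 0), (-(w : ℤ) - 2, 0), (1, (w : ℤ) + 3)} : Finset (ℤ × ℤ)) : Set (ℤ × ℤ))) :=
      subset_convexHull ℝ _ ⟨(-(w : ℤ) - 2, 0), by simp, by simp [latticeEmbed]⟩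
    have m3 : ((1 : ℝ), (w + 3 : ℝ)) ∈ convexHull ℝ (latticeEmbed ''
      (({(1, 0), (-(w : ℤ) - 2, 0), (1, (w : ℤ) + 3)} : Finset (ℤ × ℤ)) : Set (ℤ × ℤ))) :=
      subset_convexHull ℝ _ ⟨(1, (w : ℤ) + 3), by simp, by simp [latticeEmbed]⟩
    have hw : (0 : ℝ) < w + 3 := by positivity
    rcases eq_or_lt_of_le (show y ≤ w + 3 by linarith) with hy | hy
    · have : x = 1 := by linarith
      rw [this, hy]; exact m3
    · have hpos : 0 < w + 3 - y := by linarith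
      have hne : (w : ℝ) + 3 - y ≠ 0 := hpos.ne'
      have m4 := hc m1 m2 (a := (x - (y - w - 2)) / (w + 3 - y)) (b := (1 - x) / (w + 3 - y))
        (div_nonneg (by linarith) hpos.le) (div_nonneg (by linarith) hpos.le)
        (by field_simp; ring)
      have m5 := hc m4 m3 (a := (w + 3 - y) / (w + 3)) (b := y / (w + 3))
        (by positivity) (by positivity) (by field_simp; ring)
      convert m5 using 1
      ext
      · simp; field_simp; ring
      · simp; field_simp
  · refine convexHull_min ?_ ?_
    · rintro _ ⟨p, hp, rfl⟩
      simp only [Finset.coe_insert, Finset.coe_singleton, Set.mem_insert_iff,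
        Set.mem_singleton_iff] at hp
      have hw : (0 : ℝ) ≤ w := by positivity
      rcases hp with rfl | rfl | rfl <;> refine ⟨?_, ?_, ?_⟩ <;> simp [latticeEmbed] <;> linarith
    · rintro ⟨x, y⟩ ⟨h1, h2, h3⟩ ⟨x', y'⟩ ⟨h1', h2', h3'⟩ a b ha hb hab
      simp only at h1 h2 h3 h1' h2' h3'
      refine ⟨?_, ?_, ?_⟩ <;> simp
      · positivity
      · nlinarith
      · nlinarith

lemma bigTri_lattice (w : ℕ) (p : ℤ × ℤ) : latticeEmbed p ∈ bigTri w ↔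
    0 ≤ p.2 ∧ p.1 ≤ 1 ∧ p.2 - w - 2 ≤ p.1 := by
  simp only [bigTri, latticeEmbed, Set.mem_ofPred_eq]
  constructor
  · rintro ⟨h1, h2, h3⟩
    exact ⟨by exact_mod_cast h1, by exact_mod_cast h2, by exact_mod_cast h3⟩
  · rintro ⟨h1, h2, h3⟩
    exact ⟨by exact_mod_cast h1, by exact_mod_cast h2, by exact_mod_cast h3⟩

lemma bigTri_concl (w : ℕ)
    (hI : ∀ p : ℤ × ℤ, 1 ≤ p.2 → p.1 ≤ 0 → p.2 - w - 1 ≤ p.1 →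
      p ∈ interiorLatticePoints (bigTri w)) : Concl (bigTri w) w := by
  classical
  have hpol := bigTri_polygon w
  have hne : (interior (bigTri w)).Nonempty := ⟨_, hI (0, 1) (by simp) (by simp) (by simp)⟩
  obtain ⟨F, hF, hmain⟩ := row_lemma hpol hne (w + 3) (by omega) (by
      rintro q ⟨h1, h2, h3⟩
      refine ⟨h1, ?_⟩
      push_cast; linarith)
    ⟨(1, 0), (bigTri_lattice _ _).mpr ⟨by simp, by simp, by simp only; omega⟩, rfl⟩
    ⟨(1, (w + 3 : ℕ)), (bigTri_lattice _ _).mpr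
      ⟨by positivity, by simp, by push_cast; linarith⟩, rfl⟩
  have hcol : IsColumnVector (bigTri w) (0, -1) := by
    refine ⟨by simp, _, isEdge_of (α := 0) (β := -1) (γ := 0) (a := (1, 0)) (b := (0, 0))
      (by simp) ?_ ?_ ?_ (by simp) (by simp) (by simp), ?_⟩
    · rintro q ⟨h1, -⟩; simpa using h1
    · exact ⟨by simp, by simp, by simp; linarith⟩
    · exact ⟨by simp, by simp, by simp; linarith⟩
    · rintro p ⟨hp, hp2⟩
      have := (bigTri_lattice w p).mp hp
      have h0 : p.2 ≠ 0 := fun h0 => hp2 ⟨hp, by simp [latticeEmbed, h0]⟩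
      rw [bigTri_lattice]
      simp only [Prod.fst_add, Prod.snd_add]
      omega
  have hcF : F.card + 1 ≤ columnVectorCount (bigTri w) := by
    have h0 : ((0 : ℤ), (-1 : ℤ)) ∉ F := fun h => by simpa using (hF _ h).2
    rw [← Finset.card_insert_of_notMem h0, ← Set.ncard_coe_finset]
    refine Set.ncard_le_ncard ?_ (column_finite hpol hne)
    intro v hv
    rw [Finset.mem_coe, Finset.mem_insert] at hv
    rcases hv with rfl | hv
    · exact hcol
    · exact (hF v hv).1
  have hg : ((w : ℤ) + 1) * (w + 2) ≤ 2 * polygonGenus (bigTri w) := by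
    let V : Finset (Σ _ : ℕ, ℕ) := (Finset.range (w + 1)).sigma (fun b => Finset.range (b + 1))
    let f : (Σ _ : ℕ, ℕ) → ℤ × ℤ := fun s => (-(s.2 : ℤ), (w : ℤ) + 1 - s.1)
    have hf : Function.Injective f := by
      rintro ⟨a, b⟩ ⟨c, d⟩ h
      simp only [f, Prod.mk.injEq] at h
      have h1 : a = c := by omega
      have h2 : b = d := by omega
      rw [h1, h2]
    have hsub : ((V.image f : Finset (ℤ × ℤ)) : Set (ℤ × ℤ)) ⊆
        interiorLatticePoints (bigTri w) := by
      intro p hp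
      rw [Finset.mem_coe, Finset.mem_image] at hp
      obtain ⟨⟨j, x⟩, hs, rfl⟩ := hp
      rw [Finset.mem_sigma, Finset.mem_range, Finset.mem_range] at hs
      obtain ⟨h1, h2⟩ := hs
      simp only at h1 h2
      refine hI _ ?_ ?_ ?_ <;> simp only [f] <;> omega
    have h1 : V.card ≤ polygonGenus (bigTri w) := by
      rw [polygonGenus, ← Finset.card_image_of_injective V hf, ← Set.ncard_coe_finset]
      exact Set.ncard_le_ncard hsub (interior_lattice_finite hpol)
    have h2 : 2 * V.card = (w + 1) * (w + 2) := by
      rw [Finset.card_sigma]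
      simp only [Finset.card_range]
      exact tri_sum w
    have h3 : ((2 * V.card : ℕ) : ℤ) = (w + 1) * (w + 2) := by rw [h2]; push_cast; ring
    push_cast at h3
    have h4 : (V.card : ℤ) ≤ polygonGenus (bigTri w) := by exact_mod_cast h1
    linarith
  unfold Concl
  push_cast at hmain
  have hcF' : (F.card : ℤ) + 1 ≤ columnVectorCount (bigTri w) := by exact_mod_cast hcF
  set r : ℤ := (boundaryLatticeCount (bigTri w) : ℤ)
  set c : ℤ := (columnVectorCount (bigTri w) : ℤ)
  set g : ℤ := (polygonGenus (bigTri w) : ℤ)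
  have hw : (0 : ℤ) ≤ w := by positivity
  have h1 : ((w : ℤ) + 2) * (r - c) ≤ 2 * g + (2 * w + 5) * (w + 2) := by nlinarith
  have h2 := mul_le_mul_of_nonneg_left h1 (show (0 : ℤ) ≤ w + 1 by linarith)
  refine le_of_mul_le_mul_left (a := (w : ℤ) + 2) ?_ (by linarith)
  nlinarith

lemma top0 {Q : Set (ℝ × ℝ)} (hQ : IsMaximalPolygon Q) {w : ℕ} (hw : 1 ≤ w) (hlw : LWP Q w)
    (hrow : ∀ p ∈ interiorLatticePoints Q, 1 ≤ p.2 ∧ p.2 ≤ w + 1)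
    (hq : ((0 : ℤ), (w : ℤ) + 1) ∈ interiorLatticePoints Q) (x y : ℤ) (hx : 0 < x) (hxy : x < y)
    (hv : latticeEmbed (x, w + 1 + y) ∈ Q) : Concl Q w := by
  have hc := polygon_convex hQ.1
  have hcone : ∀ p ∈ interiorLatticePoints Q, p.1 ≤ 0 ∧ p.2 - w - 1 ≤ p.1 := by
    intro p hp
    obtain ⟨hp1, hp2⟩ := hrow p hp
    constructor
    · by_contra hcon
      push Not at hcon
      obtain ⟨b, hb⟩ : ∃ b : ℤ, b = w + 1 - p.2 := ⟨_, rfl⟩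
      have hb0 : 0 ≤ b := by omega
      have := hrow _ (bary hc hq hp hv (z := (1, w + 2))
        ((p.1 - 1) * (y - 1) + (x - 1) * (b + 1)) (y - x) (p.1 + b)
        (add_nonneg (mul_nonneg (by omega) (by omega)) (mul_nonneg (by omega) (by omega)))
        (by omega) (by omega) (by
          have := add_nonneg (mul_nonneg (show 0 ≤ p.1 - 1 by omega) (show 0 ≤ y - 1 by omega))
            (mul_nonneg (show 0 ≤ x - 1 by omega) (show 0 ≤ b + 1 by omega))
          omega)
        (by simp only; ring)
        (by simp only; rw [show p.2 = w + 1 - b by omega]; ring))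
      simp only at this
      omega
    · by_contra hcon
      push Not at hcon
      obtain ⟨b, hb⟩ : ∃ b : ℤ, b = w + 1 - p.2 := ⟨_, rfl⟩
      have hb0 : 0 ≤ b := by omega
      have := hrow _ (bary hc hq hp hv (z := (0, w + 2))
        ((-b - p.1 - 1) * (y - 1) + (y - x - 1) * (b + 1)) x (-p.1)
        (add_nonneg (mul_nonneg (by omega) (by omega)) (mul_nonneg (by omega) (by omega)))
        (by omega) (by omega) (by
          have := add_nonneg (mul_nonneg (show 0 ≤ -b - p.1 - 1 by omega)
            (show 0 ≤ y - 1 by omega))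
            (mul_nonneg (show 0 ≤ y - x - 1 by omega) (show 0 ≤ b + 1 by omega))
          omega)
        (by simp only; ring)
        (by simp only; rw [show p.2 = w + 1 - b by omega]; ring))
      simp only at this
      omega
  have hA : ((-w : ℤ), (1 : ℤ)) ∈ interiorLatticePoints Q := by
    obtain ⟨p, hp, hp2⟩ := hlw (fun p => (p.2, p.1 + ((w : ℤ) - 1 : ℤ)))
      ⟨0, 1, 1, 0, 0, w - 1, by norm_num, by intro p; simp⟩ (w - 1) (by omega)
    have h1 := hcone p hp
    have h2 := hrow p hp
    have h3 : ¬ (0 ≤ p.1 + ((w : ℤ) - 1) ∧ p.1 + ((w : ℤ) - 1) ≤ (w - 1 : ℕ)) := by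
      rintro ⟨h3, h4⟩
      apply hp2
      refine ⟨?_, ?_⟩
      · simp only [latticeEmbed]; exact_mod_cast h3
      · simp only [latticeEmbed]; exact_mod_cast h4
    have : p = (-(w : ℤ), 1) := by
      ext
      · simp only; omega
      · simp only; omega
    rw [← this]; exact hp
  have hB : ((0 : ℤ), (1 : ℤ)) ∈ interiorLatticePoints Q := by
    obtain ⟨p, hp, hp2⟩ := hlw (fun p => (p.1, p.1 - p.2 + ((w : ℤ) + 1 : ℤ)))
      ⟨1, 0, 1, -1, 0, w + 1, by norm_num, by intro p; simp; ring⟩ (w - 1) (by omega)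
    have h1 := hcone p hp
    have h2 := hrow p hp
    have h3 : ¬ (0 ≤ p.1 - p.2 + ((w : ℤ) + 1) ∧ p.1 - p.2 + ((w : ℤ) + 1) ≤ (w - 1 : ℕ)) := by
      rintro ⟨h3, h4⟩
      apply hp2
      refine ⟨?_, ?_⟩
      · simp only [latticeEmbed]; exact_mod_cast h3
      · simp only [latticeEmbed]; exact_mod_cast h4
    have : p = (0, 1) := by
      ext
      · simp only; omega
      · simp only; omega
    rw [← this]; exact hp
  have hT : ∀ p : ℤ × ℤ, 1 ≤ p.2 → p.1 ≤ 0 → p.2 - w - 1 ≤ p.1 →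
      p ∈ interiorLatticePoints Q := by
    intro p h1 h2 h3
    by_cases h0 : p.2 = 1 ∧ p.1 = 0
    · have : p = (0, 1) := by ext <;> simp [h0]
      rw [this]; exact hB
    · refine bary hc hq hA (interior_subset hB) (p.2 - 1) (-p.1) (w + 1 - p.2 + p.1)
        (by omega) (by omega) (by omega) (by omega) ?_ ?_
      · simp only; ring
      · simp only; ring
  have hsub : ∀ u : ℤ × ℤ, latticeEmbed u ∈ Q → latticeEmbed u ∈ bigTri w := by
    intro u hu
    rw [bigTri_lattice]
    refine ⟨?_, ?_, ?_⟩
    · by_contra hcon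
      push Not at hcon
      obtain ⟨t, ht⟩ : ∃ t : ℤ, t = 1 - u.2 := ⟨_, rfl⟩
      have e1 := Int.emod_nonneg u.1 (show t ≠ 0 by omega)
      have e2 := Int.emod_lt_of_pos u.1 (show 0 < t by omega)
      have e3 := Int.mul_ediv_add_emod u.1 t
      have := hrow _ (bary hc (hT (-1, 1) (by simp) (by simp) (by simp; omega)) hB hu
        (z := (u.1 / t, 0)) (u.1 % t) (t - 1 - u.1 % t) 1 (by omega) (by omega) (by omega)
        (by omega) (by simp only; linear_combination e3) (by simp only; rw [ht]; ring))
      simp at this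
    · by_contra hcon
      push Not at hcon
      obtain ⟨t, ht⟩ : ∃ t : ℤ, t = u.1 := ⟨_, rfl⟩
      have e1 := Int.emod_nonneg (u.2 + 2 * (t - 1)) (show t ≠ 0 by omega)
      have e2 := Int.emod_lt_of_pos (u.2 + 2 * (t - 1)) (show 0 < t by omega)
      have e3 := Int.mul_ediv_add_emod (u.2 + 2 * (t - 1)) t
      have := hcone _ (bary hc hB (hT (0, 2) (by simp) (by simp) (by simp; omega)) hu
        (z := (1, (u.2 + 2 * (t - 1)) / t)) ((u.2 + 2 * (t - 1)) % t)
        (t - 1 - (u.2 + 2 * (t - 1)) % t) 1 (by omega) (by omega) (by omega)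
        (by omega) (by simp only; rw [← ht]; ring) (by simp only; linear_combination e3))
      simp at this
    · by_contra hcon
      push Not at hcon
      obtain ⟨t, ht⟩ : ∃ t : ℤ, t = u.2 - w - 1 - u.1 := ⟨_, rfl⟩
      have e1 := Int.emod_nonneg u.1 (show t ≠ 0 by omega)
      have e2 := Int.emod_lt_of_pos u.1 (show 0 < t by omega)
      have e3 := Int.mul_ediv_add_emod u.1 t
      have := hcone _ (bary hc (hT (-1, w) (by simp; omega) (by simp) (by simp)) hq hu
        (z := (u.1 / t, u.1 / t + w + 2)) (u.1 % t) (t - 1 - u.1 % t) 1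
        (by omega) (by omega) (by omega)
        (by omega) (by simp only; linear_combination e3)
        (by simp only; linear_combination e3 + ht))
      simp only at this
      omega
  have hQT : Q ⊆ bigTri w := by
    intro q hqQ
    refine ⟨?_, ?_, ?_⟩
    · have := polygon_halfplane hQ.1 0 (-1) 0 (fun p hp => by
        have := (hsub p hp).1; simp only [latticeEmbed] at this; linarith) q hqQ
      linarith
    · have := polygon_halfplane hQ.1 1 0 1 (fun p hp => by
        have := (hsub p hp).2.1; simp only [latticeEmbed] at this; linarith) q hqQ
      linarith
    · have := polygon_halfplane hQ.1 (-1) 1 (w + 2) (fun p hp => by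
        have := (hsub p hp).2.2; simp only [latticeEmbed] at this; linarith) q hqQ
      linarith
  have hIeq : interiorLatticePoints (bigTri w) = interiorLatticePoints Q := by
    apply Set.Subset.antisymm
    · intro p hp
      have h1 := interior_strict (α := 0) (β := -1) (γ := 0) (by simp)
        (fun q (hq : q ∈ bigTri w) => by have := hq.1; linarith) hp
      have h2 := interior_strict (α := 1) (β := 0) (γ := 1) (by simp)
        (fun q (hq : q ∈ bigTri w) => by have := hq.2.1; linarith) hp
      have h3 := interior_strict (α := -1) (β := 1) (γ := w + 2) (by simp)
        (fun q (hq : q ∈ bigTri w) => by have := hq.2.2; linarith) hp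
      simp only [latticeEmbed] at h1 h2 h3
      have h1' : (0 : ℤ) < p.2 := by
        have : (0 : ℝ) < p.2 := by linarith
        exact_mod_cast this
      have h2' : p.1 < 1 := by
        have : (p.1 : ℝ) < 1 := by linarith
        exact_mod_cast this
      have h3' : p.2 < w + 2 + p.1 := by
        have : (p.2 : ℝ) < w + 2 + p.1 := by linarith
        exact_mod_cast this
      exact hT p (by omega) (by omega) (by omega)
    · intro p hp
      exact interior_mono hQT hp
  have := hQ.2 _ (bigTri_polygon w) hQT hIeq
  rw [← this]
  apply bigTri_concl
  rw [hIeq]; exact hT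

lemma top_lemma {Q : Set (ℝ × ℝ)} (hQ : IsMaximalPolygon Q) {w : ℕ} (hw : 1 ≤ w) (hlw : LWP Q w)
    (hrow : ∀ p ∈ interiorLatticePoints Q, 1 ≤ p.2 ∧ p.2 ≤ w + 1) (u : ℤ × ℤ)
    (hu : latticeEmbed u ∈ Q) (hu2 : (w : ℤ) + 3 ≤ u.2) : Concl Q w := by
  obtain ⟨q, hqI, hq2⟩ : ∃ q ∈ interiorLatticePoints Q, q.2 = w + 1 := by
    obtain ⟨p, hp, hp2⟩ := hlw (fun p => (p.1, p.2 - 1))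
      ⟨1, 0, 0, 1, 0, -1, by norm_num, by intro p; simp; ring⟩ (w - 1) (by omega)
    refine ⟨p, hp, ?_⟩
    have h2 := hrow p hp
    have h3 : ¬ (0 ≤ p.2 - 1 ∧ p.2 - 1 ≤ (w - 1 : ℕ)) := by
      rintro ⟨h3, h4⟩
      apply hp2
      refine ⟨?_, ?_⟩
      · simp only [latticeEmbed]; exact_mod_cast h3
      · simp only [latticeEmbed]; exact_mod_cast h4
    omega
  obtain ⟨X, hX⟩ : ∃ X : ℤ, X = u.1 - q.1 := ⟨_, rfl⟩
  obtain ⟨Y, hY⟩ : ∃ Y : ℤ, Y = u.2 - (w + 1) := ⟨_, rfl⟩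
  have e1 := Int.emod_nonneg X (show Y ≠ 0 by omega)
  have e2 := Int.emod_lt_of_pos X (show 0 < Y by omega)
  have e3 := Int.mul_ediv_add_emod X Y
  rcases eq_or_lt_of_le e1 with h0 | h0
  · exfalso
    have := hrow _ (bary (polygon_convex hQ.1) hqI hqI hu (z := (q.1 + X / Y, w + 2))
      (Y - 1) 0 1 (by omega) (by omega) (by omega) (by omega)
      (by simp only; linear_combination e3 + h0 + hX)
      (by simp only; rw [hq2]; linear_combination hY))
    simp only at this
    omega
  · obtain ⟨k, hk⟩ : ∃ k : ℤ, k = X / Y := ⟨_, rfl⟩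
    have hχ : IsZAffine (fun p : ℝ × ℝ => (p.1 - q.1 - k * (p.2 - (w + 1)), p.2)) :=
      ⟨1, -k, 0, 1, -q.1 + k * (w + 1), 0, by norm_num, by
        intro p; push_cast; ext <;> simp; ring⟩
    refine concl_of_image hχ hQ.1 ⟨_, hqI⟩ ?_
    obtain ⟨t, ht, ht2⟩ := interiorLatticePoints_image hχ Q
    have htv : ∀ p, t p = (p.1 - q.1 - k * (p.2 - (w + 1)), p.2) := by
      intro p
      apply latticeEmbed_inj
      rw [← ht]; simp [latticeEmbed]
    refine top0 (maximal_image hχ hQ) hw (lwp_image hχ hlw) ?_ ?_ (X % Y) Y h0 e2 ?_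
    · rw [ht2]
      rintro _ ⟨p, hp, rfl⟩
      rw [htv]; exact hrow p hp
    · rw [ht2]
      refine ⟨q, hqI, ?_⟩
      rw [htv, hq2]; simp
    · refine ⟨_, hu, ?_⟩
      refine (ht u).trans ?_
      rw [htv]
      congr 1
      ext
      · simp only; rw [hk]; linear_combination -e3 - hX + (X / Y) * hY
      · simp only; omega

lemma main_norm {Q : Set (ℝ × ℝ)} (hQ : IsMaximalPolygon Q) {w : ℕ} (hw : 1 ≤ w) (hlw : LWP Q w)
    (hrow : ∀ p ∈ interiorLatticePoints Q, 1 ≤ p.2 ∧ p.2 ≤ w + 1) : Concl Q w := by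
  obtain ⟨q, hqI, hq2⟩ : ∃ q ∈ interiorLatticePoints Q, q.2 = w + 1 := by
    obtain ⟨p, hp, hp2⟩ := hlw (fun p => (p.1, p.2 - 1))
      ⟨1, 0, 0, 1, 0, -1, by norm_num, by intro p; simp; ring⟩ (w - 1) (by omega)
    refine ⟨p, hp, ?_⟩
    have h2 := hrow p hp
    have h3 : ¬ (0 ≤ p.2 - 1 ∧ p.2 - 1 ≤ (w - 1 : ℕ)) := by
      rintro ⟨h3, h4⟩
      apply hp2
      refine ⟨?_, ?_⟩
      · simp only [latticeEmbed]; exact_mod_cast h3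
      · simp only [latticeEmbed]; exact_mod_cast h4
    omega
  obtain ⟨q', hqI', hq2'⟩ : ∃ q ∈ interiorLatticePoints Q, q.2 = 1 := by
    obtain ⟨p, hp, hp2⟩ := hlw (fun p => (p.1, p.2 - 2))
      ⟨1, 0, 0, 1, 0, -2, by norm_num, by intro p; simp; ring⟩ (w - 1) (by omega)
    refine ⟨p, hp, ?_⟩
    have h2 := hrow p hp
    have h3 : ¬ (0 ≤ p.2 - 2 ∧ p.2 - 2 ≤ (w - 1 : ℕ)) := by
      rintro ⟨h3, h4⟩
      apply hp2
      refine ⟨?_, ?_⟩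
      · simp only [latticeEmbed]; exact_mod_cast h3
      · simp only [latticeEmbed]; exact_mod_cast h4
    omega
  have hne : (interior Q).Nonempty := ⟨_, hqI⟩
  by_cases hA : ∃ u : ℤ × ℤ, latticeEmbed u ∈ Q ∧ (w : ℤ) + 3 ≤ u.2
  · obtain ⟨u, hu, hu2⟩ := hA
    exact top_lemma hQ hw hlw hrow u hu hu2
  by_cases hB : ∃ u : ℤ × ℤ, latticeEmbed u ∈ Q ∧ u.2 ≤ -1
  · obtain ⟨u, hu, hu2⟩ := hB
    have hχ : IsZAffine (fun p : ℝ × ℝ => (p.1, (w : ℝ) + 2 - p.2)) :=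
      ⟨1, 0, 0, -1, 0, w + 2, by norm_num, by intro p; push_cast; ext <;> simp; ring⟩
    refine concl_of_image hχ hQ.1 hne ?_
    obtain ⟨t, ht, ht2⟩ := interiorLatticePoints_image hχ Q
    have htv : ∀ p, t p = (p.1, w + 2 - p.2) := by
      intro p
      apply latticeEmbed_inj
      rw [← ht]; simp [latticeEmbed]
    refine top_lemma (maximal_image hχ hQ) hw (lwp_image hχ hlw) ?_ (t u) ⟨_, hu, ht u⟩ ?_
    · rw [ht2]
      rintro _ ⟨p, hp, rfl⟩
      have := hrow p hp
      rw [htv]; simp only; omega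
    · rw [htv]; simp only; omega
  push Not at hA hB
  have hstrip : ∀ q ∈ Q, 0 ≤ q.2 ∧ q.2 ≤ ((w + 2 : ℕ) : ℝ) := by
    intro z hz
    have h1 := polygon_halfplane hQ.1 0 (-1) 0 (fun p hp => by
      have h : (0 : ℤ) ≤ p.2 := by have := hB p hp; omega
      have : (0 : ℝ) ≤ p.2 := by exact_mod_cast h
      linarith) z hz
    have h2 := polygon_halfplane hQ.1 0 1 ((w + 2 : ℕ) : ℝ) (fun p hp => by
      have h : p.2 ≤ ((w + 2 : ℕ) : ℤ) := by have := hA p hp; push_cast; omega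
      have : (p.2 : ℝ) ≤ ((w + 2 : ℕ) : ℝ) := by exact_mod_cast h
      linarith) z hz
    constructor <;> linarith
  obtain ⟨F, hF, hmain⟩ := row_lemma hQ.1 hne (w + 2) (by omega) hstrip (by
      by_contra hcon
      push Not at hcon
      have := interior_strict (α := 0) (β := -1) (γ := -1) (by simp)
        (polygon_halfplane hQ.1 0 (-1) (-1) (fun p hp => by
          have h : (1 : ℤ) ≤ p.2 := by have := hB p hp; have := hcon p hp; omega
          have : (1 : ℝ) ≤ p.2 := by exact_mod_cast h
          linarith)) hqI'
      simp [latticeEmbed, hq2'] at this) (by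
      by_contra hcon
      push Not at hcon
      have := interior_strict (α := 0) (β := 1) (γ := w + 1) (by simp)
        (polygon_halfplane hQ.1 0 1 (w + 1) (fun p hp => by
          have h : p.2 ≤ (w : ℤ) + 1 := by
            have := hA p hp; have := hcon p hp; push_cast at this; omega
          have : (p.2 : ℝ) ≤ w + 1 := by exact_mod_cast h
          linarith)) hqI
      simp [latticeEmbed, hq2] at this)
  have hcF : F.card ≤ columnVectorCount Q := by
    rw [← Set.ncard_coe_finset]
    exact Set.ncard_le_ncard (fun v hv => (hF v hv).1) (column_finite hQ.1 hne)
  have hcF' : (F.card : ℤ) ≤ columnVectorCount Q := by exact_mod_cast hcF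
  unfold Concl
  push_cast at hmain
  have := mul_le_mul_of_nonneg_left hcF' (show (0 : ℤ) ≤ w + 1 by positivity)
  nlinarith

lemma ups_mem {x y : ℝ} (h1 : x + y ≤ 2) (h2 : x - 2 * y ≤ 2) (h3 : -2 ≤ 2 * x - y) :
    (x, y) ∈ twoUpsilon := by
  have hc : Convex ℝ twoUpsilon := convex_convexHull _ _
  have m1 : ((-2 : ℝ), (-2 : ℝ)) ∈ twoUpsilon := subset_convexHull ℝ _ (by simp)
  have m2 : ((2 : ℝ), (0 : ℝ)) ∈ twoUpsilon := subset_convexHull ℝ _ (by simp)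
  have m3 : ((0 : ℝ), (2 : ℝ)) ∈ twoUpsilon := subset_convexHull ℝ _ (by simp)
  rcases eq_or_lt_of_le h1 with h | h
  · convert hc m2 m3 (a := x / 2) (b := y / 2) (by linarith) (by linarith) (by linarith) using 1
    ext <;> simp
  · rcases eq_or_lt_of_le h3 with h' | h'
    · convert hc m1 m3 (a := -x / 2) (b := 1 + x / 2) (by linarith) (by linarith) (by ring) using 1
      ext <;> simp <;> linarith
    · have hs : 0 < 4 + x - 2 * y := by linarith
      have hs' : 4 + x - 2 * y ≠ 0 := hs.ne'
      have m4 := hc m1 m2 (a := (2 - x - y) / (4 + x - 2 * y))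
        (b := (2 + 2 * x - y) / (4 + x - 2 * y)) (div_nonneg (by linarith) hs.le)
        (div_nonneg (by linarith) hs.le) (by field_simp; ring)
      convert hc m4 m3 (a := (4 + x - 2 * y) / 6) (b := (2 - x + 2 * y) / 6) (by linarith)
        (by linarith) (by ring) using 1
      ext
      · simp; field_simp; ring
      · have k : (4 + x - 2 * y) / 6 * ((2 - x - y) / (4 + x - 2 * y)) = (2 - x - y) / 6 := by
          field_simp
        simp only [Prod.snd_add, Prod.smul_snd, smul_eq_mul]
        linear_combination 2 * k

lemma ups_strip : ∀ q ∈ twoUpsilon, -2 ≤ q.2 ∧ q.2 ≤ 2 := by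
  have : twoUpsilon ⊆ {q : ℝ × ℝ | -2 ≤ q.2 ∧ q.2 ≤ 2} := by
    refine convexHull_min ?_ ?_
    · rintro q hq
      simp only [Set.mem_insert_iff, Set.mem_singleton_iff] at hq
      rcases hq with rfl | rfl | rfl <;> norm_num
    · rintro ⟨x, y⟩ ⟨h1, h2⟩ ⟨x', y'⟩ ⟨h1', h2'⟩ a b ha hb hab
      simp only at h1 h2 h1' h2'
      refine ⟨?_, ?_⟩ <;> simp <;> nlinarith
  exact this

lemma ups_concl (hpol : IsLatticePolygon twoUpsilon) (hne : (interior twoUpsilon).Nonempty) :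
    Concl twoUpsilon 1 := by
  classical
  have hχ : IsZAffine (fun p : ℝ × ℝ => (p.1, p.2 + 2)) :=
    ⟨1, 0, 0, 1, 0, 2, by norm_num, by intro p; push_cast; ext <;> simp⟩
  have hint : ∀ a b : ℤ, a + b ≤ 1 → a - 2 * b ≤ 1 → -1 ≤ 2 * a - b →
      (a, b) ∈ interiorLatticePoints twoUpsilon := by
    intro a b h1 h2 h3
    have h1' : (a : ℝ) + b ≤ 1 := by exact_mod_cast h1
    have h2' : (a : ℝ) - 2 * b ≤ 1 := by exact_mod_cast h2
    have h3' : (-1 : ℝ) ≤ 2 * a - b := by exact_mod_cast h3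
    change ((a : ℝ), (b : ℝ)) ∈ interior twoUpsilon
    exact mem_interior_of (polygon_convex hpol) hne (x1 := a - 1 / 4) (x2 := a + 1 / 4)
      (a1 := a) (y1 := b - 1 / 4) (a2 := a) (y2 := b + 1 / 4)
      (ups_mem (by linarith) (by linarith) (by linarith))
      (ups_mem (by linarith) (by linarith) (by linarith))
      (ups_mem (by linarith) (by linarith) (by linarith))
      (ups_mem (by linarith) (by linarith) (by linarith))
      (by linarith) (by linarith) (by linarith) (by linarith)
  have hg : 4 ≤ polygonGenus twoUpsilon := by
    have hcard : ({(0, 0), (1, 0), (0, 1), (-1, -1)} : Finset (ℤ × ℤ)).card = 4 := by decide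
    rw [← hcard, ← Set.ncard_coe_finset]
    refine Set.ncard_le_ncard ?_ (interior_lattice_finite hpol)
    intro p hp
    simp only [Finset.coe_insert, Finset.coe_singleton, Set.mem_insert_iff,
      Set.mem_singleton_iff] at hp
    rcases hp with rfl | rfl | rfl | rfl <;> apply hint <;> norm_num
  refine concl_of_image hχ hpol hne ?_
  have hpol' := isLatticePolygon_image hχ hpol
  have hne' : (interior ((fun p : ℝ × ℝ => (p.1, p.2 + 2)) '' twoUpsilon)).Nonempty := by
    obtain ⟨t, ht, ht2⟩ := interiorLatticePoints_image hχ twoUpsilon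
    have : t (0, 0) ∈ interiorLatticePoints ((fun p : ℝ × ℝ => (p.1, p.2 + 2)) '' twoUpsilon) := by
      rw [ht2]; exact ⟨_, hint 0 0 (by norm_num) (by norm_num) (by norm_num), rfl⟩
    exact ⟨_, this⟩
  rw [← genus_image hχ] at hg
  obtain ⟨F, hF, hmain⟩ := row_lemma hpol' hne' 4 (by norm_num) (by
      rintro _ ⟨q, hq, rfl⟩
      have := ups_strip q hq
      simp only; push_cast
      constructor <;> linarith)
    ⟨(-2, 0), ⟨(-2, -2), ups_mem (by norm_num) (by norm_num) (by norm_num),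
      by simp [latticeEmbed]⟩, rfl⟩
    ⟨(0, 4), ⟨(0, 2), ups_mem (by norm_num) (by norm_num) (by norm_num),
      by simp [latticeEmbed]; norm_num⟩, rfl⟩
  have hcF : F.card ≤ columnVectorCount ((fun p : ℝ × ℝ => (p.1, p.2 + 2)) '' twoUpsilon) := by
    rw [← Set.ncard_coe_finset]
    exact Set.ncard_le_ncard (fun v hv => (hF v hv).1) (column_finite hpol' hne')
  unfold Concl
  push_cast at hmain ⊢
  omega

lemma final_ineq {P : Set (ℝ × ℝ)} {w : ℕ} (h : Concl P w) :
    (polygonGenus P : ℝ) + (boundaryLatticeCount P : ℝ) - 3 - (columnVectorCount P : ℝ) ≤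
      (polygonGenus P : ℝ) + 2 * (polygonGenus P : ℝ) / (((w + 2 : ℕ) : ℝ) - 1) +
        2 * ((w + 2 : ℕ) : ℝ) - 3 := by
  have h' : ((w : ℝ) + 1) * ((boundaryLatticeCount P : ℝ) - columnVectorCount P) ≤
    2 * polygonGenus P + 2 * (w + 2) * (w + 1) := by unfold Concl at h; exact_mod_cast h
  have hw : (0 : ℝ) < w + 1 := by positivity
  have h2 : (boundaryLatticeCount P : ℝ) - columnVectorCount P ≤
      2 * polygonGenus P / (w + 1) + 2 * (w + 2) := by
    rw [← sub_le_iff_le_add, le_div_iff₀ hw]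
    linarith
  push_cast
  rw [show (w : ℝ) + 2 - 1 = w + 1 by ring]
  linarith

lemma lwp_of {P : Set (ℝ × ℝ)} {w : ℕ} (hnh : NonHyperelliptic P)
    (hw : LatticeWidthIs (interiorPolygon P) w) : LWP P w := by
  intro χ hχ s hs
  by_contra hcon
  push Not at hcon
  obtain ⟨a, b, c, d, e, f, hD, hφ⟩ := id hχ
  have hsub : interiorPolygon P ⊆ {q : ℝ × ℝ | 0 ≤ c * q.1 + d * q.2 + f ∧
      c * q.1 + d * q.2 + f ≤ s} := by
    refine convexHull_min ?_ ?_
    · rintro _ ⟨p, hp, rfl⟩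
      have := hcon p hp
      rw [hφ] at this
      exact this
    · rintro ⟨x, y⟩ ⟨h1, h2⟩ ⟨x', y'⟩ ⟨h1', h2'⟩ α β ha hb hab
      simp only at h1 h2 h1' h2'
      have k1 := mul_nonneg ha h1
      have k2 := mul_nonneg hb h1'
      have k3 := mul_le_mul_of_nonneg_left h2 ha
      have k4 := mul_le_mul_of_nonneg_left h2' hb
      have k5 : β = 1 - α := by linarith
      subst k5
      refine ⟨?_, ?_⟩ <;> simp <;> linarith
  rcases Nat.eq_zero_or_pos s with h0 | h0
  · obtain ⟨q, hq⟩ := hnh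
    have hcd : (c : ℝ) ≠ 0 ∨ (d : ℝ) ≠ 0 := by
      by_contra hcd
      push Not at hcd
      have hc0 : c = 0 := by exact_mod_cast hcd.1
      have hd0 : d = 0 := by exact_mod_cast hcd.2
      simp [hc0, hd0] at hD
    have := interior_strict (γ := (s : ℝ) - f) hcd
      (fun q hq => by have := (hsub hq).2; linarith) hq
    have h2 := (hsub (interior_subset hq)).1
    rw [h0] at this
    simp at this
    linarith
  · have := hw.2 (show s ∈ _ from ⟨h0, χ, hχ, by
      rintro _ ⟨q, hq, rfl⟩
      rw [hφ]; exact hsub hq⟩)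
    omega

/-- For a maximal non-hyperelliptic lattice polygon `P` of expected gonality `d ≥ 3`
with `g` interior lattice points, `g + r(P) − 3 − c(P) ≤ g + 2g/(d−1) + 2d − 3`. -/
theorem stmt1 (P : Set (ℝ × ℝ)) (d : ℕ)
    (hP : IsMaximalPolygon P) (hnh : NonHyperelliptic P)
    (hegon : ExpectedGonalityIs P d) (hd : 3 ≤ d) :
    (polygonGenus P : ℝ) + (boundaryLatticeCount P : ℝ) - 3 - (columnVectorCount P : ℝ) ≤
      (polygonGenus P : ℝ) + 2 * (polygonGenus P : ℝ) / ((d : ℝ) - 1) + 2 * (d : ℝ) - 3 := by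
  have hne : (interior P).Nonempty := by
    have h1 : (interiorPolygon P).Nonempty := hnh.mono interior_subset
    rw [interiorPolygon, convexHull_nonempty_iff, Set.image_nonempty] at h1
    obtain ⟨p, hp⟩ := h1
    exact ⟨_, hp⟩
  rcases hegon with ⟨⟨φ, hφ, hφP⟩, rfl⟩ | ⟨-, w, hw, rfl⟩
  · refine final_ineq (w := 1) (concl_of_image hφ hP.1 hne ?_)
    have hpol := isLatticePolygon_image hφ hP.1
    have hne' : (interior (φ '' P)).Nonempty := by
      obtain ⟨e, t, m, rfl, -⟩ := zaff_pack hφ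
      rw [aff_interior]; exact hne.image _
    rw [hφP] at hpol hne' ⊢
    exact ups_concl hpol hne'
  · have hlw := lwp_of hnh hw
    obtain ⟨hw0, φ, hφ, hsub⟩ := hw.1
    have hs : IsZAffine (fun p : ℝ × ℝ => (p.1, p.2 + 1)) :=
      ⟨1, 0, 0, 1, 0, 1, by norm_num, by intro p; push_cast; ext <;> simp⟩
    have hχ := zaff_comp hs hφ
    refine final_ineq (concl_of_image hχ hP.1 hne
      (main_norm (maximal_image hχ hP) hw0 (lwp_image hχ hlw) ?_))
    obtain ⟨t, ht, ht2⟩ := interiorLatticePoints_image hχ P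
    rw [ht2]
    rintro _ ⟨p, hp, rfl⟩
    have h1 : φ (latticeEmbed p) ∈ strip (w : ℝ) :=
      hsub ⟨_, subset_convexHull ℝ _ ⟨p, hp, rfl⟩, rfl⟩
    have h2 := congrArg Prod.snd (ht p)
    simp only [Function.comp, latticeEmbed] at h2
    obtain ⟨h3, h4⟩ := h1
    simp only [latticeEmbed] at h3 h4
    have h5 : (1 : ℝ) ≤ (t p).2 := by linarith
    have h6 : ((t p).2 : ℝ) ≤ w + 1 := by linarith
    exact ⟨by exact_mod_cast h5, by exact_mod_cast h6⟩
end

section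
/- Let d ≥ 1 be an integer and let P be a two-dimensional lattice polygon contained in the strip ℝ × [0, d] that meets both lines ℝ × {0} and ℝ × {d}. Then r(P) ≤ |P ∩ (ℤ × {0})| + |P ∩ (ℤ × {d})| + 2(d − 1), with equality if and only if for every integer i with 1 ≤ i ≤ d − 1 the boundary ∂P contains exactly two points of ℤ × {i}. -/
open Set

theorem aux_interior (P : Set (ℝ × ℝ)) (hc : Convex ℝ P) (hcl : IsClosed P)
    (h2 : (interior P).Nonempty) (d y a b c : ℝ) (hy0 : 0 < y) (hyd : y < d)
    (h0 : ∃ q ∈ P, q.2 = (0 : ℝ)) (hdl : ∃ q ∈ P, q.2 = d)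
    (ha : (a, y) ∈ P) (hcP : (c, y) ∈ P) (hab : a < b) (hbc : b < c) :
    (b, y) ∈ interior P := by
  by_contra hb
  obtain ⟨f, hf⟩ := geometric_hahn_banach_open_point hc.interior isOpen_interior hb
  have hle : ∀ x ∈ P, f x ≤ f (b, y) := by
    intro x hx
    have hx' : x ∈ closure (interior P) := by
      rw [hc.closure_interior_eq_closure_of_nonempty_interior h2]
      exact subset_closure hx
    have hcl2 : IsClosed {x | f x ≤ f (b, y)} := isClosed_le f.continuous continuous_const
    exact closure_minimal (fun z hz => (hf z hz).le) hcl2 hx'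
  have hlin : ∀ u v : ℝ, f (u, v) = u * f (1, 0) + v * f (0, 1) := by
    intro u v
    have : ((u, v) : ℝ × ℝ) = u • ((1 : ℝ), (0 : ℝ)) + v • ((0 : ℝ), (1 : ℝ)) := by
      ext <;> simp
    rw [this, map_add, map_smul, map_smul]; simp
  obtain ⟨⟨q1, q2⟩, hq, hq2⟩ := h0
  obtain ⟨⟨r1, r2⟩, hr, hr2⟩ := hdl
  obtain ⟨⟨z1, z2⟩, hz⟩ := h2
  simp only at hq2 hr2
  subst hq2 hr2
  have e1 := hle _ ha
  have e2 := hle _ hcP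
  have e3 := hle _ hq
  have e4 := hle _ hr
  have e5 := hf _ hz
  rw [hlin, hlin b y] at e1 e2 e3 e4 e5
  generalize f (1, 0) = α at *
  generalize f (0, 1) = β at *
  have hα : α = 0 := by
    apply le_antisymm <;> nlinarith
  subst hα
  have hβ : β = 0 := by
    apply le_antisymm <;> nlinarith
  subst hβ
  simp at e5

theorem aux_two (P : Set (ℝ × ℝ)) (hc : Convex ℝ P) (hcl : IsClosed P)
    (h2 : (interior P).Nonempty) (d y : ℝ) (hy0 : 0 < y) (hyd : y < d)
    (h0 : ∃ q ∈ P, q.2 = (0 : ℝ)) (hdl : ∃ q ∈ P, q.2 = d) :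
    {x : ℤ | ((x : ℝ), y) ∈ frontier P}.ncard ≤ 2 := by
  by_contra hcon
  push Not at hcon
  have hfin := Set.finite_of_ncard_pos (lt_trans (by norm_num) hcon)
  rw [Set.two_lt_ncard_iff hfin] at hcon
  obtain ⟨a, b, c, ha, hb, hc', hab, hac, hbc⟩ := hcon
  have key : ∀ u v w : ℤ, ((u : ℝ), y) ∈ frontier P → ((v : ℝ), y) ∈ frontier P →
      ((w : ℝ), y) ∈ frontier P → u < v → v < w → False := by
    intro u v w hu hv hw huv hvw
    exact hv.2 (aux_interior P hc hcl h2 d y u v w hy0 hyd h0 hdl (hcl.frontier_subset hu)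
      (hcl.frontier_subset hw) (by exact_mod_cast huv) (by exact_mod_cast hvw))
  have k1 := key a b c ha hb hc'
  have k2 := key a c b ha hc' hb
  have k3 := key b a c hb ha hc'
  have k4 := key b c a hb hc' ha
  have k5 := key c a b hc' ha hb
  have k6 := key c b a hc' hb ha
  by_cases a < b <;> by_cases b < c <;> by_cases a < c <;> grind

/-- For a two-dimensional lattice polygon `P ⊆ ℝ × [0, d]` meeting both boundary lines,
`r(P) ≤ |P ∩ (ℤ × {0})| + |P ∩ (ℤ × {d})| + 2(d−1)`, with equality iff each intermediate
horizontal lattice line meets `∂P` in exactly two lattice points. -/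
theorem stmt2 (d : ℕ) (hd : 1 ≤ d) (P : Set (ℝ × ℝ))
    (hP : IsLatticePolygon P) (h2 : TwoDimensional P)
    (hsub : P ⊆ strip (d : ℝ))
    (h0 : ∃ q ∈ P, q.2 = (0 : ℝ)) (hdl : ∃ q ∈ P, q.2 = (d : ℝ)) :
    boundaryLatticeCount P ≤
        {x : ℤ | ((x : ℝ), (0 : ℝ)) ∈ P}.ncard +
          {x : ℤ | ((x : ℝ), (d : ℝ)) ∈ P}.ncard + 2 * (d - 1) ∧
      (boundaryLatticeCount P =
          {x : ℤ | ((x : ℝ), (0 : ℝ)) ∈ P}.ncard +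
            {x : ℤ | ((x : ℝ), (d : ℝ)) ∈ P}.ncard + 2 * (d - 1) ↔
        ∀ i : ℕ, 1 ≤ i → i ≤ d - 1 →
          {x : ℤ | ((x : ℝ), (i : ℝ)) ∈ frontier P}.ncard = 2) := by
  have hcv : Convex ℝ P := by
    obtain ⟨S, -, rfl⟩ := hP
    exact convex_convexHull ℝ _
  have hcp : IsCompact P := by
    obtain ⟨S, -, rfl⟩ := hP
    exact (S.finite_toSet.image _).isCompact_convexHull (𝕜 := ℝ)
  have hcl := hcp.isClosed
  have hfr : frontier P ⊆ P := hcl.frontier_subset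
  have hint : ∀ q ∈ interior P, 0 < q.2 ∧ q.2 < d := by
    intro q hq
    have h1 : P ⊆ Prod.snd ⁻¹' (Set.Icc (0 : ℝ) d) := fun z hz => hsub hz
    have h3 := interior_mono h1 hq
    rw [← isOpenMap_snd.preimage_interior_eq_interior_preimage continuous_snd, interior_Icc] at h3
    exact h3
  have hr0 : {x : ℤ | ((x : ℝ), (0 : ℝ)) ∈ P} = {x : ℤ | ((x : ℝ), (0 : ℝ)) ∈ frontier P} := by
    ext x
    refine ⟨fun h => ⟨subset_closure h, fun h' => ?_⟩, fun h => hfr h⟩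
    exact lt_irrefl _ (hint _ h').1
  have hrd : {x : ℤ | ((x : ℝ), (d : ℝ)) ∈ P} = {x : ℤ | ((x : ℝ), (d : ℝ)) ∈ frontier P} := by
    ext x
    refine ⟨fun h => ⟨subset_closure h, fun h' => ?_⟩, fun h => hfr h⟩
    exact lt_irrefl _ (hint _ h').2
  have hfin : {p : ℤ × ℤ | latticeEmbed p ∈ frontier P}.Finite := by
    obtain ⟨R, hR⟩ := hcp.isBounded.subset_closedBall 0
    refine Set.Finite.subset ((Set.finite_Icc (-⌈R⌉) ⌈R⌉).prod (Set.finite_Icc (-⌈R⌉) ⌈R⌉)) ?_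
    rintro ⟨a, b⟩ hp
    have h := hR (hfr hp)
    rw [mem_closedBall_zero_iff, latticeEmbed, Prod.norm_def, max_le_iff, Real.norm_eq_abs,
      Real.norm_eq_abs, abs_le, abs_le] at h
    have hR' := Int.le_ceil R
    obtain ⟨⟨h1, h2⟩, h3, h4⟩ := h
    simp only at h1 h2 h3 h4
    refine ⟨⟨?_, ?_⟩, ?_, ?_⟩ <;> simp only <;> rify <;> linarith
  set r : ℕ → ℕ := fun i => {x : ℤ | ((x : ℝ), (i : ℝ)) ∈ frontier P}.ncard with hr
  have hsum : boundaryLatticeCount P = ∑ i ∈ Finset.range (d + 1), r i := by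
    have hmaps : ∀ p ∈ hfin.toFinset, p.2.toNat ∈ Finset.range (d + 1) := by
      rintro ⟨a, b⟩ hp
      rw [Set.Finite.mem_toFinset] at hp
      have h := hsub (hfr hp)
      have h' : (b : ℝ) ≤ d := h.2
      have : b ≤ d := by exact_mod_cast h'
      simp; omega
    rw [boundaryLatticeCount, Set.ncard_eq_toFinset_card _ hfin,
      Finset.card_eq_sum_card_fiberwise hmaps]
    refine Finset.sum_congr rfl fun i _ => ?_
    rw [← Set.ncard_coe_finset, hr]
    have : (({p ∈ hfin.toFinset | p.2.toNat = i} : Finset (ℤ × ℤ)) : Set (ℤ × ℤ)) =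
        (fun x : ℤ => (x, (i : ℤ))) '' {x : ℤ | ((x : ℝ), (i : ℝ)) ∈ frontier P} := by
      ext ⟨a, b⟩
      simp only [Finset.coe_filter, Set.Finite.mem_toFinset, Set.mem_setOf_eq, Set.mem_image,
        Prod.mk.injEq, latticeEmbed]
      constructor
      · rintro ⟨h, hb⟩
        have h' : (0 : ℝ) ≤ b := (hsub (hfr h)).1
        have h'' : 0 ≤ b := by exact_mod_cast h'
        have hbi : b = (i : ℤ) := by omega
        subst hbi
        exact ⟨a, by simpa using h, rfl, rfl⟩
      · rintro ⟨x, hx, rfl, rfl⟩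
        exact ⟨by simpa using hx, by simp⟩
    rw [this, Set.ncard_image_of_injective]
    intro x y hxy
    exact (Prod.mk.inj hxy).1
  have hle : ∀ i ∈ Finset.range (d - 1), r (i + 1) ≤ 2 := by
    intro i hi
    rw [Finset.mem_range] at hi
    refine aux_two P hcv hcl h2 d _ ?_ ?_ h0 hdl
    · exact_mod_cast Nat.succ_pos i
    · have : i + 1 < d := by omega
      exact_mod_cast this
  have h0' : {x : ℤ | ((x : ℝ), (0 : ℝ)) ∈ P}.ncard = r 0 := by rw [hr0, hr]; simp
  have hd' : {x : ℤ | ((x : ℝ), (d : ℝ)) ∈ P}.ncard = r d := by rw [hrd]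
  have hsplit : boundaryLatticeCount P = r 0 + r d + ∑ i ∈ Finset.range (d - 1), r (i + 1) := by
    rw [hsum, Finset.sum_range_succ]
    obtain ⟨e, rfl⟩ : ∃ e, d = e + 1 := ⟨d - 1, by omega⟩
    rw [Finset.sum_range_succ']
    simp only [Nat.add_sub_cancel]
    omega
  have hconst : 2 * (d - 1) = ∑ i ∈ Finset.range (d - 1), 2 := by simp [mul_comm]
  rw [h0', hd', hsplit, hconst]
  refine ⟨Nat.add_le_add_left (Finset.sum_le_sum hle) _, ?_⟩
  rw [Nat.add_left_cancel_iff, Finset.sum_eq_sum_iff_of_le hle]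
  constructor
  · intro h i h1 hi
    have := h (i - 1) (by rw [Finset.mem_range]; omega)
    rwa [Nat.sub_add_cancel h1] at this
  · intro h i hi
    rw [Finset.mem_range] at hi
    exact h (i + 1) (by omega) (by omega)
end
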